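/- arXiv:2003.05829 — 4 statements merged into one kernel-verified Lean document; each statement's English description precedes it below -/
import Mathlib

section
/- Let k ≥ 1 be an integer. There is a constant C > 0 (depending only on k) such that for every twice continuously differentiable w : (0,∞) → ℝ with w(r) → 0 as r → 0, finite ‖w‖_H² := ∫₀^∞ (w'² + k² w²/r²) r dr and finite D² := ∫₀^∞ (w''² + k² (w')²/r²) r dr, one has ∫₀^∞ w(r)⁶ r^{-3} dr ≤ C ‖w‖_H⁴ D² and ∫₀^∞ w(r)⁶ r^{-5} dr ≤ C ‖w‖_H² D⁴ (equivalently, ‖r^{-2} w³‖_{L²} ≲ ‖w‖_H² ‖∂_r w‖_H and ‖r^{-3} w³‖_{L²} ≲ ‖w‖_H ‖∂_r w‖_H², with the L² norm taken with respect to r dr). -/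
open MeasureTheory Set Filter

/-- A radial profile with finite `H`-norm is bounded by that norm. -/
theorem sq_le_integral_of_hasDerivAt {k : ℕ} (hk : 1 ≤ k) {u u' : ℝ → ℝ}
    (hu : ∀ r ∈ Ioi (0 : ℝ), HasDerivAt u (u' r) r)
    (hint : IntegrableOn (fun r => (u' r ^ 2 + (k : ℝ) ^ 2 * u r ^ 2 / r ^ 2) * r) (Ioi 0))
    {r : ℝ} (hr : 0 < r) :
    u r ^ 2 ≤ ∫ s in Ioi (0 : ℝ), (u' s ^ 2 + (k : ℝ) ^ 2 * u s ^ 2 / s ^ 2) * s := by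
  have hk1 : (1 : ℝ) ≤ (k : ℝ) ^ 2 := one_le_pow₀ (by exact_mod_cast hk)
  have hlow : ∀ s : ℝ, 0 < s →
      (u' s ^ 2 + u s ^ 2 / s ^ 2) * s ≤ (u' s ^ 2 + (k : ℝ) ^ 2 * u s ^ 2 / s ^ 2) * s := by
    intro s hs
    gcongr
    nlinarith [sq_nonneg (u s)]
  refine le_of_forall_pos_le_add fun ε hε => ?_
  obtain ⟨a, ha, har, hua⟩ : ∃ a, 0 < a ∧ a < r ∧ u a ^ 2 < ε := by
    by_contra! hcon
    have hI : IntegrableOn (fun s : ℝ => s⁻¹) (Ioc 0 r) := by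
      rw [integrableOn_Ioc_iff_integrableOn_Ioo]
      refine Integrable.mono' (g := fun s => ε⁻¹ *
        ((u' s ^ 2 + (k : ℝ) ^ 2 * u s ^ 2 / s ^ 2) * s))
        ((hint.mono_set Ioo_subset_Ioi_self).const_mul _)
        measurable_inv.aestronglyMeasurable ?_
      filter_upwards [ae_restrict_mem measurableSet_Ioo] with s hs
      have hs0 : 0 < s := hs.1
      rw [Real.norm_of_nonneg (inv_nonneg.2 hs0.le), ← div_eq_inv_mul, le_div_iff₀ hε]
      refine le_trans ?_ (hlow s hs0)
      have h1 : (u' s ^ 2 + u s ^ 2 / s ^ 2) * s = u' s ^ 2 * s + s⁻¹ * u s ^ 2 := by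
        field_simp
      rw [h1]
      have h2 := mul_le_mul_of_nonneg_left (hcon s hs0 hs.2) (inv_nonneg.2 hs0.le)
      have h3 : 0 ≤ u' s ^ 2 * s := by positivity
      linarith
    rw [← intervalIntegrable_iff_integrableOn_Ioc_of_le hr.le, intervalIntegrable_inv_iff] at hI
    rcases hI with h | h
    · exact hr.ne h
    · exact h left_mem_uIcc
  have hd : ∀ x ∈ Icc a r, HasDerivAt (fun x => u x ^ 2) (2 * u x * u' x) x := by
    intro x hx
    have h := (hu x (ha.trans_le hx.1)).fun_pow 2
    simpa using h
  have hsub : Icc a r ⊆ Ioi 0 := fun x hx => ha.trans_le hx.1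
  have hmain := intervalIntegral.sub_le_integral_of_hasDeriv_right_of_le har.le
    (fun x hx => (hd x hx).continuousAt.continuousWithinAt)
    (fun x hx => (hd x (Ioo_subset_Icc_self hx)).hasDerivWithinAt)
    (hint.mono_set hsub)
    (fun x hx => by
      have hx0 : 0 < x := ha.trans hx.1
      refine le_trans ?_ (hlow x hx0)
      have h1 : (u' x ^ 2 + u x ^ 2 / x ^ 2) * x - 2 * u x * u' x
          = (u' x - u x / x) ^ 2 * x := by
        field_simp
        ring
      have h2 : 0 ≤ (u' x - u x / x) ^ 2 * x := by positivity
      linarith)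
  rw [intervalIntegral.integral_of_le har.le] at hmain
  have hmono : (∫ s in Ioc a r, (u' s ^ 2 + (k : ℝ) ^ 2 * u s ^ 2 / s ^ 2) * s) ≤
      ∫ s in Ioi (0 : ℝ), (u' s ^ 2 + (k : ℝ) ^ 2 * u s ^ 2 / s ^ 2) * s := by
    refine setIntegral_mono_set hint ?_ (Ioc_subset_Icc_self.trans hsub).eventuallyLE
    filter_upwards [ae_restrict_mem measurableSet_Ioi] with s hs
    have hs0 : 0 < s := hs
    simp only [Pi.zero_apply]
    positivity
  linarith

/-- A function on `(0,∞)` vanishing at `0` with derivative bounded by `M` is at most `M r`. -/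
theorem abs_le_mul_of_hasDerivAt_of_tendsto_zero {w w' : ℝ → ℝ} {M : ℝ}
    (hw : ∀ r ∈ Ioi (0 : ℝ), HasDerivAt w (w' r) r)
    (h0 : Tendsto w (nhdsWithin 0 (Ioi 0)) (nhds 0))
    (hM : ∀ r ∈ Ioi (0 : ℝ), |w' r| ≤ M) {r : ℝ} (hr : 0 < r) : |w r| ≤ M * r := by
  have hid : Tendsto (fun a : ℝ => a) (nhdsWithin 0 (Ioi 0)) (nhds 0) :=
    tendsto_id.mono_left nhdsWithin_le_nhds
  have h1 : Tendsto (fun a => |w r - w a|) (nhdsWithin 0 (Ioi 0)) (nhds |w r - 0|) :=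
    (h0.const_sub _).abs
  have h2 : Tendsto (fun a => M * |r - a|) (nhdsWithin 0 (Ioi 0)) (nhds (M * |r - 0|)) :=
    ((hid.const_sub _).abs).const_mul _
  have h3 := le_of_tendsto_of_tendsto h1 h2 (by
    filter_upwards [self_mem_nhdsWithin] with a ha
    exact (convex_Ioi (0 : ℝ)).norm_image_sub_le_of_norm_hasDerivWithin_le
      (fun x hx => (hw x hx).hasDerivWithinAt) hM ha hr)
  simpa [abs_of_pos hr] using h3

/-- the cubic weighted estimates
`‖r⁻² w³‖_{L²} ≲ ‖w‖_H² ‖∂_r w‖_H` and `‖r⁻³ w³‖_{L²} ≲ ‖w‖_H ‖∂_r w‖_H²`,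
stated in squared form for radial profiles on `(0,∞)` with measure `r dr`. -/
theorem stmt1 (k : ℕ) (hk : 1 ≤ k) :
    ∃ C : ℝ, 0 < C ∧
      ∀ w w' w'' : ℝ → ℝ,
        (∀ r ∈ Ioi (0 : ℝ), HasDerivAt w (w' r) r) →
        (∀ r ∈ Ioi (0 : ℝ), HasDerivAt w' (w'' r) r) →
        ContinuousOn w'' (Ioi 0) →
        Tendsto w (nhdsWithin 0 (Ioi 0)) (nhds 0) →
        IntegrableOn (fun r => (w' r ^ 2 + (k : ℝ) ^ 2 * w r ^ 2 / r ^ 2) * r) (Ioi 0) →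
        IntegrableOn (fun r => (w'' r ^ 2 + (k : ℝ) ^ 2 * w' r ^ 2 / r ^ 2) * r) (Ioi 0) →
        (∫ s in Ioi (0 : ℝ), w s ^ 6 / s ^ 3) ≤
            C * (∫ s in Ioi (0 : ℝ), (w' s ^ 2 + (k : ℝ) ^ 2 * w s ^ 2 / s ^ 2) * s) ^ 2 *
              (∫ s in Ioi (0 : ℝ), (w'' s ^ 2 + (k : ℝ) ^ 2 * w' s ^ 2 / s ^ 2) * s) ∧
        (∫ s in Ioi (0 : ℝ), w s ^ 6 / s ^ 5) ≤
            C * (∫ s in Ioi (0 : ℝ), (w' s ^ 2 + (k : ℝ) ^ 2 * w s ^ 2 / s ^ 2) * s) *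
              (∫ s in Ioi (0 : ℝ), (w'' s ^ 2 + (k : ℝ) ^ 2 * w' s ^ 2 / s ^ 2) * s) ^ 2 := by
  refine ⟨1, one_pos, fun w w' w'' hw hw' _ h0 hE hD => ?_⟩
  have hk1 : (1 : ℝ) ≤ (k : ℝ) ^ 2 := one_le_pow₀ (by exact_mod_cast hk)
  have hwE := fun r (hr : 0 < r) => sq_le_integral_of_hasDerivAt hk hw hE hr
  have hwD := fun r (hr : 0 < r) => sq_le_integral_of_hasDerivAt hk hw' hD hr
  set E := ∫ s in Ioi (0 : ℝ), (w' s ^ 2 + (k : ℝ) ^ 2 * w s ^ 2 / s ^ 2) * s with hEdef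
  set D := ∫ s in Ioi (0 : ℝ), (w'' s ^ 2 + (k : ℝ) ^ 2 * w' s ^ 2 / s ^ 2) * s
  have hE0 : 0 ≤ E := (sq_nonneg _).trans (hwE 1 one_pos)
  have hD0 : 0 ≤ D := (sq_nonneg _).trans (hwD 1 one_pos)
  have hwr : ∀ r, 0 < r → w r ^ 2 / r ^ 2 ≤ D := by
    intro r hr
    have h1 := abs_le_mul_of_hasDerivAt_of_tendsto_zero (M := √D) hw h0
      (fun x hx => Real.abs_le_sqrt (hwD x hx)) hr
    rw [div_le_iff₀ (by positivity), ← sq_abs (w r)]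
    calc |w r| ^ 2 ≤ (√D * r) ^ 2 := by gcongr
      _ = D * r ^ 2 := by rw [mul_pow, Real.sq_sqrt hD0]
  have hden : ∀ s, 0 < s → w s ^ 2 / s ≤ (w' s ^ 2 + (k : ℝ) ^ 2 * w s ^ 2 / s ^ 2) * s := by
    intro s hs
    have h1 : (w' s ^ 2 + (k : ℝ) ^ 2 * w s ^ 2 / s ^ 2) * s
        = w' s ^ 2 * s + (k : ℝ) ^ 2 * (w s ^ 2 / s) := by
      field_simp
    have h2 : 0 ≤ w' s ^ 2 * s := by positivity
    have h3 : 0 ≤ w s ^ 2 / s := by positivity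
    nlinarith
  have hbound : ∀ (f : ℝ → ℝ) (A : ℝ), 0 ≤ A → (∀ s, 0 < s → 0 ≤ f s) →
      (∀ s, 0 < s → f s ≤ A * (w s ^ 2 / s)) → (∫ s in Ioi (0 : ℝ), f s) ≤ A * E := by
    intro f A hA hf0 hf
    rw [hEdef, ← integral_const_mul]
    refine integral_mono_of_nonneg ?_ (hE.const_mul A) ?_
    · filter_upwards [ae_restrict_mem measurableSet_Ioi] with s hs using hf0 s hs
    · filter_upwards [ae_restrict_mem measurableSet_Ioi] with s hs
      exact (hf s hs).trans (mul_le_mul_of_nonneg_left (hden s hs) hA)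
  constructor
  · refine (hbound _ (D * E) (by positivity) (fun s hs => by positivity)
      fun s hs => ?_).trans_eq (by ring)
    calc w s ^ 6 / s ^ 3 = w s ^ 2 / s ^ 2 * w s ^ 2 * (w s ^ 2 / s) := by field_simp
      _ ≤ D * E * (w s ^ 2 / s) := by
        gcongr
        · exact hwr s hs
        · exact hwE s hs
  · refine (hbound _ (D * D) (by positivity) (fun s hs => by positivity)
      fun s hs => ?_).trans_eq (by ring)
    calc w s ^ 6 / s ^ 5 = w s ^ 2 / s ^ 2 * (w s ^ 2 / s ^ 2) * (w s ^ 2 / s) := by field_simp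
      _ ≤ D * D * (w s ^ 2 / s) := by
        gcongr
        · exact hwr s hs
        · exact hwr s hs
end

section
/- Let k ≥ 4 be an integer. There exist infinitely differentiable functions A, B, B̃ : (0,∞) → ℝ satisfying: L A = -Λ₀ΛQ, L B = γ_k ΛQ - 4 r^{k-2} (ΛQ)², and L B̃ = -γ_k ΛQ + 4 r^{-k-2} (ΛQ)² pointwise on (0,∞); the orthogonality relations ∫₀^∞ A(r) ΛQ(r) r dr = ∫₀^∞ B(r) ΛQ(r) r dr = ∫₀^∞ B̃(r) ΛQ(r) r dr = 0; the asymptotics as r → 0: A(r), B(r) = O(r^k), A'(r), B'(r) = O(r^{k-1}), A''(r), B''(r) = O(r^{k-2}), while B̃(r) = O(r^k |log r|), B̃'(r) = O(r^{k-1} |log r|), B̃''(r) = O(r^{k-2} |log r|); the asymptotics as r → ∞: A(r), B(r), B̃(r) = O(r^{-k+2}), their first derivatives are O(r^{-k+1}) and their second derivatives are O(r^{-k}); and moreover A, ΛA, Λ₀ΛA, B, ΛB, Λ₀ΛB, B̃, ΛB̃, Λ₀ΛB̃ all belong to L²((0,∞), r dr). -/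
open MeasureTheory Set Filter Asymptotics

noncomputable section

/-- The `k`-equivariant harmonic map profile `Q(r) = 2 arctan(r^k)`. -/
def Qfun (k : ℕ) (r : ℝ) : ℝ := 2 * Real.arctan (r ^ k)

/-- `ΛQ(r) = r Q'(r) = 2k r^k / (1 + r^{2k})`. -/
def LamQ (k : ℕ) (r : ℝ) : ℝ := 2 * k * r ^ k / (1 + r ^ (2 * k))

/-- The `H`-scaling generator `Λg = r g'`. -/
def LamV (g : ℝ → ℝ) : ℝ → ℝ := fun r => r * deriv g r

/-- The `L²`-scaling generator `Λ₀g = g + r g'`. -/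
def Lam0V (g : ℝ → ℝ) : ℝ → ℝ := fun r => g r + r * deriv g r

/-- The linearized operator `L g = -g'' - g'/r + (k²/r²) cos(2Q) g`. -/
def Lop (k : ℕ) (g : ℝ → ℝ) : ℝ → ℝ := fun r =>
  -deriv (deriv g) r - deriv g r / r + (k : ℝ) ^ 2 / r ^ 2 * Real.cos (2 * Qfun k r) * g r

/-- `ρ_k = ((8k/π) sin(π/k))^{1/2}`. -/
def rhoK (k : ℕ) : ℝ := Real.sqrt (8 * k / Real.pi * Real.sin (Real.pi / k))

/-- `γ_k = (k/2) ρ_k²`. -/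
def gammaK (k : ℕ) : ℝ := (k : ℝ) / 2 * rhoK k ^ 2

open Topology

lemma LamQ_pos {k : ℕ} (hk : 0 < k) {r : ℝ} (hr : 0 < r) : 0 < LamQ k r := by
  unfold LamQ; positivity

lemma contDiff_LamQ (k : ℕ) : ContDiff ℝ (⊤ : ℕ∞) (LamQ k) := by
  unfold LamQ
  refine ContDiff.div (by fun_prop) (by fun_prop) fun x => ?_
  have := (even_two_mul k).pow_nonneg x
  positivity

/-- Euler's integral `∫₀¹ (x/(1-x))^a dx = πa / sin(πa)`. -/
lemma integral_odds_rpow {a : ℝ} (ha : 0 < a) (ha1 : a < 1) :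
    ∫ x in Ioo (0 : ℝ) 1, (x / (1 - x)) ^ a = a * (Real.pi / Real.sin (Real.pi * a)) := by
  have h := ProbabilityTheory.beta_eq_betaIntegralReal (1 + a) (1 - a) (by linarith) (by linarith)
  have hb : ProbabilityTheory.beta (1 + a) (1 - a) = a * (Real.pi / Real.sin (Real.pi * a)) := by
    rw [ProbabilityTheory.beta, ← Real.Gamma_mul_Gamma_one_sub a, add_comm 1 a,
      Real.Gamma_add_one ha.ne']
    rw [show a + 1 + (1 - a) = 2 by ring, Real.Gamma_two]
    ring
  rw [← hb, h, Complex.betaIntegral, intervalIntegral.integral_of_le zero_le_one,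
    ← RCLike.re_eq_complex_re, ← integral_re]
  · rw [integral_Ioc_eq_integral_Ioo]
    refine setIntegral_congr_fun measurableSet_Ioo fun x hx => ?_
    have h1 : (0 : ℝ) < 1 - x := by linarith [hx.2]
    have e1 : (x : ℂ) ^ (((1 + a : ℝ) : ℂ) - 1) = ((x ^ a : ℝ) : ℂ) := by
      rw [Complex.ofReal_cpow hx.1.le]; norm_num
    have e2 : (1 - (x : ℂ)) ^ (((1 - a : ℝ) : ℂ) - 1) = (((1 - x) ^ (-a) : ℝ) : ℂ) := by
      rw [Complex.ofReal_cpow h1.le]; norm_num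
    simp only [e1, e2, ← Complex.ofReal_mul, RCLike.re_eq_complex_re, Complex.ofReal_re]
    rw [Real.div_rpow hx.1.le h1.le, Real.rpow_neg h1.le, div_eq_mul_inv]
  · refine ((intervalIntegrable_iff_integrableOn_Ioc_of_le zero_le_one).1
      (Complex.betaIntegral_convergent ?_ ?_))
    · rw [Complex.ofReal_re]; linarith
    · rw [Complex.ofReal_re]; linarith

lemma integral_LamQ_sq {k : ℕ} (hk : 2 ≤ k) :
    ∫ r in Ioi (0 : ℝ), LamQ k r ^ 2 * r = 2 * Real.pi / Real.sin (Real.pi / k) := by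
  have hk0 : (0 : ℝ) < k := by positivity
  set φ : ℝ → ℝ := fun r => r ^ (2 * k) / (1 + r ^ (2 * k)) with hφ
  have himg : φ '' Ioi 0 = Ioo 0 1 := by
    ext y
    constructor
    · rintro ⟨r, hr, rfl⟩
      have : 0 < r ^ (2 * k) := pow_pos hr _
      exact ⟨by simp only [hφ]; positivity, by
        simp only [hφ]; rw [div_lt_one (by positivity)]; linarith⟩
    · rintro ⟨h0, h1⟩
      have h2 : 0 < 1 - y := by linarith
      refine ⟨(y / (1 - y)) ^ (((2 * k : ℕ) : ℝ)⁻¹), ?_, ?_⟩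
      · exact Real.rpow_pos_of_pos (by positivity) _
      · simp only [hφ]
        rw [Real.rpow_inv_natCast_pow (by positivity) (by lia)]
        field_simp
        ring
  have hinj : InjOn φ (Ioi 0) := by
    intro x hx y hy hxy
    have hx' : 0 < x ^ (2 * k) := pow_pos hx _
    have hy' : 0 < y ^ (2 * k) := pow_pos hy _
    simp only [hφ] at hxy
    rw [div_eq_div_iff (by positivity) (by positivity)] at hxy
    exact (pow_left_inj₀ (le_of_lt hx) (le_of_lt hy) (n := 2 * k) (by lia)).1 (by linarith)
  have hder : ∀ r ∈ Ioi (0 : ℝ), HasDerivWithinAt φ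
      (2 * k * r ^ (2 * k - 1) / (1 + r ^ (2 * k)) ^ 2) (Ioi 0) r := by
    intro r hr
    have hr' : 0 < r ^ (2 * k) := pow_pos hr _
    have hp := hasDerivAt_pow (2 * k) r
    have := hp.div (hp.const_add 1) (by positivity)
    refine (this.congr_deriv ?_).hasDerivWithinAt
    push_cast
    field_simp
    ring
  have key := integral_image_eq_integral_abs_deriv_smul measurableSet_Ioi hder hinj
    (fun x => (x / (1 - x)) ^ ((1 : ℝ) / k))
  rw [himg, integral_odds_rpow (by positivity) (by
    rw [div_lt_one hk0]; exact_mod_cast hk)] at key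
  have e : ∀ r ∈ Ioi (0 : ℝ), LamQ k r ^ 2 * r = 2 * k *
      (|2 * k * r ^ (2 * k - 1) / (1 + r ^ (2 * k)) ^ 2| •
        (φ r / (1 - φ r)) ^ ((1 : ℝ) / k)) := by
    intro r hr
    have hr0 : 0 < r := hr
    have h1 : φ r / (1 - φ r) = (r ^ 2) ^ k := by
      simp only [hφ]; rw [← pow_mul]; field_simp; simp
    have h2 : ((r ^ 2) ^ k) ^ ((1 : ℝ) / k) = r ^ 2 := by
      rw [one_div, Real.pow_rpow_inv_natCast (by positivity) (by lia)]
    rw [h1, h2, abs_of_pos (by positivity), smul_eq_mul, LamQ]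
    have : r ^ (2 * k) = r ^ (2 * k - 1) * r := by rw [← pow_succ]; congr 1; lia
    have h3 : (r ^ k) ^ 2 = r ^ (2 * k - 1) * r := by rw [← this, ← pow_mul, mul_comm]
    field_simp
    rw [h3]
    ring
  rw [setIntegral_congr_fun measurableSet_Ioi e, integral_const_mul, ← key]
  field_simp

lemma gammaK_mul_integral {k : ℕ} (hk : 2 ≤ k) :
    gammaK k * ∫ r in Ioi (0 : ℝ), LamQ k r ^ 2 * r = 8 * k ^ 2 := by
  have hs : 0 < Real.sin (Real.pi / k) :=
    Real.sin_pos_of_pos_of_lt_pi (by positivity)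
      (div_lt_self Real.pi_pos (by exact_mod_cast hk))
  rw [integral_LamQ_sq hk, gammaK, rhoK, Real.sq_sqrt (by positivity)]
  field_simp

lemma HasDerivAt.contDiffOn_infty {f f' : ℝ → ℝ} (h : ∀ r ∈ Ioi (0 : ℝ), HasDerivAt f (f' r) r)
    (hf' : ContDiffOn ℝ (⊤ : ℕ∞) f' (Ioi 0)) : ContDiffOn ℝ (⊤ : ℕ∞) f (Ioi 0) :=
  (contDiffOn_infty_iff_deriv_of_isOpen isOpen_Ioi).2
    ⟨fun r hr => (h r hr).differentiableAt.differentiableWithinAt,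
      hf'.congr fun r hr => (h r hr).deriv⟩

/-- `cos Q = (1 - r^{2k}) / (1 + r^{2k})`. -/
def cosQ (k : ℕ) (r : ℝ) : ℝ := (1 - r ^ (2 * k)) / (1 + r ^ (2 * k))

lemma abs_cosQ_le {k : ℕ} {r : ℝ} (hr : 0 < r) : |cosQ k r| ≤ 1 := by
  have : 0 < r ^ (2 * k) := pow_pos hr _
  rw [cosQ, abs_le, le_div_iff₀ (by positivity), div_le_one (by positivity)]
  constructor <;> linarith

lemma cos_two_mul_Qfun (k : ℕ) (r : ℝ) : Real.cos (2 * Qfun k r) = 2 * cosQ k r ^ 2 - 1 := by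
  have : 0 < 1 + (r ^ k) ^ 2 := by positivity
  rw [Qfun, Real.cos_two_mul, Real.cos_two_mul, Real.cos_sq_arctan, cosQ, mul_comm 2 k, pow_mul]
  congr 3
  field_simp
  ring

lemma hasDerivAt_LamQ {k : ℕ} (hk : 0 < k) {r : ℝ} (hr : 0 < r) :
    HasDerivAt (LamQ k) (k * cosQ k r * LamQ k r / r) r := by
  have h1 := ((hasDerivAt_pow k r).const_mul (2 * k : ℝ)).div
    ((hasDerivAt_pow (2 * k) r).const_add 1) (by positivity)
  refine h1.congr_deriv ?_
  rw [cosQ, LamQ]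
  have e1 : r ^ k = r ^ (k - 1) * r := by rw [← pow_succ]; congr 1; lia
  have e2 : r ^ (2 * k) = r ^ (2 * k - 1) * r := by rw [← pow_succ]; congr 1; lia
  push_cast
  rw [e1, e2]
  have : 0 < 1 + r ^ (2 * k - 1) * r := by positivity
  field_simp
  ring

lemma hasDerivAt_cosQ {k : ℕ} (hk : 0 < k) {r : ℝ} (hr : 0 < r) :
    HasDerivAt (cosQ k) (-k * (1 - cosQ k r ^ 2) / r) r := by
  have hp := hasDerivAt_pow (2 * k) r
  refine ((hp.const_sub 1).div (hp.const_add 1) (by positivity)).congr_deriv ?_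
  rw [cosQ]
  have e2 : r ^ (2 * k) = r ^ (2 * k - 1) * r := by rw [← pow_succ]; congr 1; lia
  push_cast
  rw [e2]
  have : 0 < 1 + r ^ (2 * k - 1) * r := by positivity
  field_simp
  ring

lemma LamQ_le_pow (k : ℕ) {r : ℝ} (hr : 0 < r) : LamQ k r ≤ 2 * k * r ^ k := by
  rw [LamQ]
  exact div_le_self (by positivity) (by linarith [pow_pos hr (2 * k)])

lemma LamQ_le_zpow (k : ℕ) {r : ℝ} (hr : 0 < r) : LamQ k r ≤ 2 * k * r ^ (-(k : ℤ)) := by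
  rw [LamQ, zpow_neg, zpow_natCast, div_le_iff₀ (by positivity)]
  have h : 2 * k * (r ^ k)⁻¹ * (1 + r ^ (2 * k)) = 2 * k * (r ^ k)⁻¹ + 2 * k * r ^ k := by
    rw [mul_comm 2 k, pow_mul]
    field_simp
  rw [h]
  have : 0 ≤ 2 * k * (r ^ k)⁻¹ := by positivity
  linarith

lemma eventually_pos_nhdsGT_zero : ∀ᶠ r : ℝ in 𝓝[>] 0, 0 < r := self_mem_nhdsWithin

lemma LamQ_isBigO_zero {k : ℕ} (hk : 0 < k) : LamQ k =O[𝓝[>] 0] fun r => r ^ k := by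
  refine IsBigO.of_bound (2 * k) ?_
  filter_upwards [eventually_pos_nhdsGT_zero] with r hr
  rw [Real.norm_of_nonneg (LamQ_pos hk hr).le, Real.norm_of_nonneg (by positivity)]
  exact LamQ_le_pow k hr

lemma LamQ_isBigO_atTop {k : ℕ} (hk : 0 < k) : LamQ k =O[atTop] fun r => r ^ (-(k : ℤ)) := by
  refine IsBigO.of_bound (2 * k) ?_
  filter_upwards [eventually_gt_atTop 0] with r hr
  rw [Real.norm_of_nonneg (LamQ_pos hk hr).le, Real.norm_of_nonneg (by positivity)]
  exact LamQ_le_zpow k hr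

lemma isBigO_pow_one {n : ℕ} : (fun r : ℝ => r ^ n) =O[𝓝[>] 0] fun _ => (1 : ℝ) :=
  (((continuous_pow n).tendsto 0).mono_left nhdsWithin_le_nhds).isBigO_one ℝ

lemma isBigO_zpow_atTop {m n : ℤ} (h : m ≤ n) :
    (fun r : ℝ => r ^ m) =O[atTop] fun r : ℝ => r ^ n := by
  refine IsBigO.of_bound 1 ?_
  filter_upwards [eventually_ge_atTop 1] with r hr
  rw [Real.norm_of_nonneg (by positivity), Real.norm_of_nonneg (by positivity), one_mul]
  exact zpow_le_zpow_right₀ hr h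

lemma integrableOn_mul_mul_id {f g : ℝ → ℝ} (hf : ContinuousOn f (Ioi 0))
    (hg : ContinuousOn g (Ioi 0)) (hf0 : f =O[𝓝[>] 0] fun _ => (1 : ℝ))
    (hg0 : g =O[𝓝[>] 0] fun _ => (1 : ℝ)) (hft : f =O[atTop] fun r => r ^ (-2 : ℤ))
    (hgt : g =O[atTop] fun r => r ^ (-2 : ℤ)) :
    IntegrableOn (fun r => f r * g r * r) (Ioi 0) := by
  have h := mellin_convergent_of_isBigO_scalar (f := fun r => f r * g r) (a := 4) (b := 0) (s := 2)
    ((hf.mul hg).locallyIntegrableOn measurableSet_Ioi)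
    ((hft.mul hgt).congr' EventuallyEq.rfl (by
      filter_upwards [eventually_gt_atTop 0] with r hr
      rw [← zpow_add₀ hr.ne', ← Real.rpow_intCast]
      norm_num))
    (by norm_num) ((hf0.mul hg0).congr' EventuallyEq.rfl (by simp)) (by norm_num)
  refine h.congr_fun (fun r hr => ?_) measurableSet_Ioi
  norm_num
  ring

lemma LamQ_isBigO_one {k : ℕ} (hk : 0 < k) : LamQ k =O[𝓝[>] 0] fun _ => (1 : ℝ) :=
  (LamQ_isBigO_zero hk).trans isBigO_pow_one

lemma LamQ_isBigO_zpow_neg_two {k : ℕ} (hk : 2 ≤ k) : LamQ k =O[atTop] fun r => r ^ (-2 : ℤ) :=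
  (LamQ_isBigO_atTop (by lia)).trans (isBigO_zpow_atTop (by lia))

lemma integrableOn_LamQ_sq {k : ℕ} (hk : 2 ≤ k) :
    IntegrableOn (fun r => LamQ k r ^ 2 * r) (Ioi 0) := by
  have hc := (contDiff_LamQ k).continuous.continuousOn (s := Ioi 0)
  have h0 := LamQ_isBigO_one (by lia : 0 < k)
  have ht := LamQ_isBigO_zpow_neg_two hk
  simpa only [sq] using integrableOn_mul_mul_id hc hc h0 h0 ht ht

/-- `h` together with its first two derivatives `h₁`, `h₂`, of size `w` near `0` and of size `r²`
near `∞` in the scale-invariant sense. -/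
structure IsMultiplier (w h h₁ h₂ : ℝ → ℝ) : Prop where
  smooth : ContDiffOn ℝ (⊤ : ℕ∞) h (Ioi 0)
  hasDerivAt : ∀ r ∈ Ioi (0 : ℝ), HasDerivAt h (h₁ r) r
  hasDerivAt' : ∀ r ∈ Ioi (0 : ℝ), HasDerivAt h₁ (h₂ r) r
  zero : h =O[𝓝[>] 0] w
  zero₁ : (fun r => r * h₁ r) =O[𝓝[>] 0] w
  zero₂ : (fun r => r ^ 2 * h₂ r) =O[𝓝[>] 0] w
  top : h =O[atTop] fun r => r ^ 2
  top₁ : (fun r => r * h₁ r) =O[atTop] fun r => r ^ 2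
  top₂ : (fun r => r ^ 2 * h₂ r) =O[atTop] fun r => r ^ 2

/-- `g` is a solution of `L g = F`, orthogonal to `ΛQ`, with the decay and integrability required
of the profiles; `w` is the loss near the origin. -/
structure IsProfile (k : ℕ) (w F g : ℝ → ℝ) : Prop where
  smooth : ContDiffOn ℝ (⊤ : ℕ∞) g (Ioi 0)
  eqn : ∀ r ∈ Ioi (0 : ℝ), Lop k g r = F r
  orthogonal : ∫ r in Ioi (0 : ℝ), g r * LamQ k r * r = 0
  zero : g =O[𝓝[>] 0] fun r => r ^ k * w r
  zero₁ : deriv g =O[𝓝[>] 0] fun r => r ^ (k - 1) * w r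
  zero₂ : deriv (deriv g) =O[𝓝[>] 0] fun r => r ^ (k - 2) * w r
  top : g =O[atTop] fun r => r ^ (2 - (k : ℤ))
  top₁ : deriv g =O[atTop] fun r => r ^ (1 - (k : ℤ))
  top₂ : deriv (deriv g) =O[atTop] fun r => r ^ (-(k : ℤ))
  memL2 : IntegrableOn (fun r => g r ^ 2 * r) (Ioi 0)
  memL2₁ : IntegrableOn (fun r => LamV g r ^ 2 * r) (Ioi 0)
  memL2₂ : IntegrableOn (fun r => Lam0V (LamV g) r ^ 2 * r) (Ioi 0)

section Multiplier

variable {k : ℕ} {h h₁ h₂ w : ℝ → ℝ}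

lemma deriv_LamQ_mul (hk : 0 < k) (hd : ∀ r ∈ Ioi (0 : ℝ), HasDerivAt h (h₁ r) r) {r : ℝ}
    (hr : 0 < r) : deriv (fun r => LamQ k r * h r) r
      = LamQ k r / r * (k * cosQ k r * h r + r * h₁ r) := by
  refine (((hasDerivAt_LamQ hk hr).mul (hd r hr)).congr_deriv ?_).deriv
  field_simp

lemma deriv_deriv_LamQ_mul (hk : 0 < k) (hd : ∀ r ∈ Ioi (0 : ℝ), HasDerivAt h (h₁ r) r)
    (hd' : ∀ r ∈ Ioi (0 : ℝ), HasDerivAt h₁ (h₂ r) r) {r : ℝ} (hr : 0 < r) :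
    deriv (deriv fun r => LamQ k r * h r) r
      = LamQ k r / r ^ 2 * ((k ^ 2 * (2 * cosQ k r ^ 2 - 1) - k * cosQ k r) * h r
        + 2 * k * cosQ k r * (r * h₁ r) + r ^ 2 * h₂ r) := by
  have e : deriv (fun r => LamQ k r * h r) =ᶠ[𝓝 r]
      fun r => LamQ k r / r * (k * cosQ k r * h r + r * h₁ r) := by
    filter_upwards [Ioi_mem_nhds hr] with s hs using deriv_LamQ_mul hk hd hs
  rw [e.deriv_eq]
  have hc := ((hasDerivAt_cosQ hk hr).const_mul (k : ℝ)).mul (hd r hr)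
  have hs := (hasDerivAt_id r).mul (hd' r hr)
  have hq := (hasDerivAt_LamQ hk hr).div (hasDerivAt_id r) hr.ne'
  refine ((hq.mul (hc.add hs)).congr_deriv ?_).deriv
  simp only [id, Pi.add_apply, Pi.mul_apply, Pi.div_apply]
  field_simp
  ring

lemma Lop_LamQ_mul (hk : 0 < k) (hd : ∀ r ∈ Ioi (0 : ℝ), HasDerivAt h (h₁ r) r)
    (hd' : ∀ r ∈ Ioi (0 : ℝ), HasDerivAt h₁ (h₂ r) r) {r : ℝ} (hr : 0 < r) :
    Lop k (fun r => LamQ k r * h r) r = -(LamQ k r / r ^ 2 *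
      ((2 * k * cosQ k r + 1) * (r * h₁ r) + r ^ 2 * h₂ r)) := by
  rw [Lop, deriv_deriv_LamQ_mul hk hd hd' hr, deriv_LamQ_mul hk hd hr, cos_two_mul_Qfun]
  field_simp
  ring

lemma isBigO_LamQ_mul (hk : 0 < k) {l : Filter ℝ} {φ : ℝ → ℝ} (hl : ∀ᶠ r in l, 0 < r)
    (hφ : LamQ k =O[l] φ) (hd : ∀ r ∈ Ioi (0 : ℝ), HasDerivAt h (h₁ r) r)
    (hd' : ∀ r ∈ Ioi (0 : ℝ), HasDerivAt h₁ (h₂ r) r) (h0 : h =O[l] w)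
    (h1 : (fun r => r * h₁ r) =O[l] w) (h2 : (fun r => r ^ 2 * h₂ r) =O[l] w) :
    (fun r => LamQ k r * h r) =O[l] (fun r => φ r * w r) ∧
    (fun r => r * deriv (fun r => LamQ k r * h r) r) =O[l] (fun r => φ r * w r) ∧
    (fun r => r ^ 2 * deriv (deriv fun r => LamQ k r * h r) r) =O[l] (fun r => φ r * w r) := by
  have hc : cosQ k =O[l] fun _ => (1 : ℝ) := by
    refine IsBigO.of_bound 1 ?_
    filter_upwards [hl] with r hr
    simpa using abs_cosQ_le hr
  have hc2 : (fun r => cosQ k r ^ 2) =O[l] fun _ => (1 : ℝ) := by simpa using hc.pow 2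
  have hone : (fun _ : ℝ => (1 : ℝ)) =O[l] fun _ => (1 : ℝ) := isBigO_refl _ _
  refine ⟨hφ.mul h0, ?_, ?_⟩
  · have hb : (fun r => k * cosQ k r * h r + r * h₁ r) =O[l] w :=
      (((hc.const_mul_left (k : ℝ)).mul h0).congr_right (by simp)).add h1
    refine (hφ.mul hb).congr' ?_ EventuallyEq.rfl
    filter_upwards [hl] with r hr
    rw [deriv_LamQ_mul hk hd hr]
    field_simp
  · have hb : (fun r => (k ^ 2 * (2 * cosQ k r ^ 2 - 1) - k * cosQ k r) * h r
        + 2 * k * cosQ k r * (r * h₁ r) + r ^ 2 * h₂ r) =O[l] w := by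
      refine ((IsBigO.congr_right ((IsBigO.sub ?_ (hc.const_mul_left (k : ℝ))).mul h0)
        (by simp)).add (((hc.const_mul_left (2 * k : ℝ)).mul h1).congr_right (by simp))).add h2
      exact ((hc2.const_mul_left 2).sub hone).const_mul_left _
    refine (hφ.mul hb).congr' ?_ EventuallyEq.rfl
    filter_upwards [hl] with r hr
    rw [deriv_deriv_LamQ_mul hk hd hd' hr]
    field_simp

lemma IsMultiplier.sub_const (hh : IsMultiplier w h h₁ h₂) (hw : (fun _ => (1 : ℝ)) =O[𝓝[>] 0] w)
    (c : ℝ) : IsMultiplier w (fun r => h r - c) h₁ h₂ where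
  smooth := hh.smooth.sub contDiffOn_const
  hasDerivAt r hr := (hh.hasDerivAt r hr).sub_const c
  hasDerivAt' := hh.hasDerivAt'
  zero := hh.zero.sub ((isBigO_const_const c one_ne_zero _).trans hw)
  zero₁ := hh.zero₁
  zero₂ := hh.zero₂
  top := hh.top.sub ((isBigO_const_const c one_ne_zero _).trans (by
    simpa using isBigO_zpow_atTop (m := 0) (n := 2) (by norm_num)))
  top₁ := hh.top₁
  top₂ := hh.top₂

lemma IsBigO.of_mul_pow_left {l : Filter ℝ} {f φ ψ : ℝ → ℝ} (n : ℕ) (hl : ∀ᶠ r in l, 0 < r)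
    (hf : (fun r => r ^ n * f r) =O[l] φ) (hψ : ∀ r, 0 < r → φ r = r ^ n * ψ r) : f =O[l] ψ := by
  refine ((isBigO_refl (fun r : ℝ => (r ^ n)⁻¹) l).mul hf).congr' ?_ ?_
  · filter_upwards [hl] with r hr
    field_simp
  · filter_upwards [hl] with r hr
    rw [hψ r hr]
    field_simp

lemma isBigO_one_of_pow_mul (hk : 0 < k) (hw : (fun r => r * w r) =O[𝓝[>] 0] fun _ => (1 : ℝ)) :
    (fun r => r ^ k * w r) =O[𝓝[>] 0] fun _ => (1 : ℝ) := by
  obtain ⟨n, rfl⟩ := Nat.exists_eq_succ_of_ne_zero hk.ne'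
  refine ((isBigO_pow_one (n := n)).mul hw).congr (fun r => ?_) (by simp)
  rw [pow_succ]
  ring

theorem IsMultiplier.exists_isProfile (hk : 4 ≤ k) (hh : IsMultiplier w h h₁ h₂)
    (hw : (fun _ => (1 : ℝ)) =O[𝓝[>] 0] w)
    (hw' : (fun r => r * w r) =O[𝓝[>] 0] fun _ => (1 : ℝ)) {F : ℝ → ℝ}
    (hF : ∀ r ∈ Ioi (0 : ℝ), -(LamQ k r / r ^ 2 *
      ((2 * k * cosQ k r + 1) * (r * h₁ r) + r ^ 2 * h₂ r)) = F r) :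
    ∃ g, IsProfile k w F g := by
  have hk0 : 0 < k := by lia
  have hΦc : Continuous (LamQ k) := (contDiff_LamQ k).continuous
  have hzpow : ∀ r : ℝ, 0 < r → r ^ (-(k : ℤ)) * r ^ 2 = r ^ (2 - (k : ℤ)) := fun r hr => by
    rw [← zpow_natCast r 2, ← zpow_add₀ hr.ne']
    congr 1
    push_cast
    ring
  have hztop : (fun r : ℝ => r ^ (-(k : ℤ)) * r ^ 2) =O[atTop] fun r => r ^ (-2 : ℤ) := by
    refine (isBigO_zpow_atTop (m := 2 - (k : ℤ)) (by lia)).congr' ?_ EventuallyEq.rfl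
    filter_upwards [eventually_gt_atTop 0] with r hr using (hzpow r hr).symm
  have hgh : IntegrableOn (fun r => LamQ k r * h r * LamQ k r * r) (Ioi 0) :=
    integrableOn_mul_mul_id (hΦc.continuousOn.mul hh.smooth.continuousOn) hΦc.continuousOn
      (((LamQ_isBigO_zero hk0).mul hh.zero).trans (isBigO_one_of_pow_mul hk0 hw'))
      (LamQ_isBigO_one hk0)
      (((LamQ_isBigO_atTop hk0).mul hh.top).trans hztop)
      (LamQ_isBigO_zpow_neg_two (by lia))
  have hΦΦ := integrableOn_LamQ_sq (by lia : 2 ≤ k)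
  have hpos : ∫ r in Ioi (0 : ℝ), LamQ k r ^ 2 * r ≠ 0 := by
    intro h0
    have := gammaK_mul_integral (k := k) (by lia)
    rw [h0, mul_zero] at this
    exact absurd this (by positivity)
  set c : ℝ := (∫ r in Ioi (0 : ℝ), LamQ k r * h r * LamQ k r * r) /
    ∫ r in Ioi (0 : ℝ), LamQ k r ^ 2 * r with hc
  have hm := hh.sub_const hw c
  set g : ℝ → ℝ := fun r => LamQ k r * (h r - c) with hg
  obtain ⟨z0, z1, z2⟩ := isBigO_LamQ_mul hk0 eventually_pos_nhdsGT_zero (LamQ_isBigO_zero hk0)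
    hm.hasDerivAt hm.hasDerivAt' hm.zero hm.zero₁ hm.zero₂
  obtain ⟨t0, t1, t2⟩ := isBigO_LamQ_mul hk0 (eventually_gt_atTop 0) (LamQ_isBigO_atTop hk0)
    hm.hasDerivAt hm.hasDerivAt' hm.top hm.top₁ hm.top₂
  rw [← hg] at z0 z1 z2 t0 t1 t2
  have hsm : ContDiffOn ℝ (⊤ : ℕ∞) g (Ioi 0) := (contDiff_LamQ k).contDiffOn.mul hm.smooth
  have hsm1 := ((contDiffOn_infty_iff_deriv_of_isOpen isOpen_Ioi).1 hsm).2
  have hsm2 := ((contDiffOn_infty_iff_deriv_of_isOpen isOpen_Ioi).1 hsm1).2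
  have hw0 := isBigO_one_of_pow_mul hk0 hw'
  have L2 : ∀ f : ℝ → ℝ, ContinuousOn f (Ioi 0) → f =O[𝓝[>] 0] (fun r => r ^ k * w r) →
      f =O[atTop] (fun r => r ^ (-(k : ℤ)) * r ^ 2) →
      IntegrableOn (fun r => f r ^ 2 * r) (Ioi 0) := fun f hf h0 ht => by
    simpa only [sq] using integrableOn_mul_mul_id hf hf (h0.trans hw0) (h0.trans hw0)
      (ht.trans hztop) (ht.trans hztop)
  have hLam : ∀ r ∈ Ioi (0 : ℝ), Lam0V (LamV g) r =
      2 * (r * deriv g r) + r ^ 2 * deriv (deriv g) r := fun r hr => by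
    have hd : HasDerivAt (deriv g) (deriv (deriv g) r) r :=
      ((hsm1.differentiableOn (by simp)).differentiableAt (Ioi_mem_nhds hr)).hasDerivAt
    have := ((hasDerivAt_id r).mul hd).deriv
    simp only [id] at this
    rw [Lam0V, show LamV g = id * deriv g from rfl, this, Pi.mul_apply, id]
    ring
  refine ⟨g, hsm, fun r hr => ?_, ?_, z0, ?_, ?_, ?_, ?_, ?_, L2 g hsm.continuousOn z0 t0,
    L2 _ (continuousOn_id.mul hsm1.continuousOn) z1 t1, ?_⟩
  · rw [hg, Lop_LamQ_mul hk0 hm.hasDerivAt hm.hasDerivAt' hr]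
    exact hF r hr
  · have e : ∀ r, g r * LamQ k r * r =
        LamQ k r * h r * LamQ k r * r - c * (LamQ k r ^ 2 * r) := fun r => by
      rw [hg]; ring
    simp only [e]
    rw [integral_sub hgh (hΦΦ.const_mul c), integral_const_mul, hc, div_mul_cancel₀ _ hpos,
      sub_self]
  · refine IsBigO.of_mul_pow_left 1 eventually_pos_nhdsGT_zero (by simpa using z1) fun r hr => ?_
    rw [← mul_assoc, ← pow_add, Nat.add_sub_cancel' (by lia)]
  · refine IsBigO.of_mul_pow_left 2 eventually_pos_nhdsGT_zero z2 fun r hr => ?_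
    rw [← mul_assoc, ← pow_add, Nat.add_sub_cancel' (by lia)]
  · refine t0.congr' EventuallyEq.rfl ?_
    filter_upwards [eventually_gt_atTop 0] with r hr using hzpow r hr
  · refine IsBigO.of_mul_pow_left 1 (eventually_gt_atTop 0) (by simpa only [pow_one] using t1) fun r hr => ?_
    rw [hzpow r hr, pow_one, ← zpow_one_add₀ hr.ne']
    congr 1
    ring
  · exact IsBigO.of_mul_pow_left 2 (eventually_gt_atTop 0) t2 fun r _ => mul_comm _ _
  · refine (L2 (fun r => 2 * (r * deriv g r) + r ^ 2 * deriv (deriv g) r) ?_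
      ((z1.const_mul_left 2).add z2) ((t1.const_mul_left 2).add t2)).congr_fun
      (fun r hr => ?_) measurableSet_Ioi
    · exact (continuousOn_const.mul (continuousOn_id.mul hsm1.continuousOn)).add
        ((continuousOn_id.pow 2).mul hsm2.continuousOn)
    · simp only [hLam r hr]

end Multiplier

lemma IsMultiplier.of_bound {h₁ h₂ : ℝ → ℝ} {C : ℝ} (hs : ContDiffOn ℝ (⊤ : ℕ∞) h₁ (Ioi 0))
    (hd : ∀ r ∈ Ioi (0 : ℝ), HasDerivAt h₁ (h₂ r) r)
    (b₁ : ∀ r, 0 < r → |r * h₁ r| ≤ C * r ^ 2) (b₂ : ∀ r, 0 < r → |r ^ 2 * h₂ r| ≤ C * r ^ 2) :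
    IsMultiplier (fun _ => 1) (fun r => ∫ s in (1 : ℝ)..r, h₁ s) h₁ h₂ := by
  have hC : 0 ≤ C := by simpa using (abs_nonneg _).trans (b₁ 1 one_pos)
  have hder : ∀ r ∈ Ioi (0 : ℝ), HasDerivAt (fun r => ∫ s in (1 : ℝ)..r, h₁ s) (h₁ r) r :=
    fun r hr => intervalIntegral.integral_hasDerivAt_right
      ((hs.continuousOn.mono fun x hx =>
        (lt_min one_pos hr).trans_le (mem_Icc.1 hx).1).intervalIntegrable)
      (hs.continuousOn.stronglyMeasurableAtFilter isOpen_Ioi r hr)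
      (hs.continuousOn.continuousAt (Ioi_mem_nhds hr))
  have hb : ∀ r, 0 < r → |∫ s in (1 : ℝ)..r, h₁ s| ≤ C * max 1 r * |r - 1| := fun r hr => by
    rw [← Real.norm_eq_abs]
    refine intervalIntegral.norm_integral_le_of_norm_le_const fun s hs => ?_
    have hs0 : 0 < s := (lt_min one_pos hr).trans hs.1
    have h1 := b₁ s hs0
    rw [abs_mul, abs_of_pos hs0, sq, ← mul_assoc, mul_comm, mul_le_mul_iff_left₀ hs0] at h1
    exact h1.trans (mul_le_mul_of_nonneg_left hs.2 hC)
  have zero_of : ∀ f : ℝ → ℝ, (∀ r, 0 < r → |f r| ≤ C * r ^ 2) →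
      f =O[𝓝[>] 0] fun _ => (1 : ℝ) := fun f hf => by
    refine IsBigO.trans (IsBigO.of_bound C ?_) (isBigO_pow_one (n := 2))
    filter_upwards [eventually_pos_nhdsGT_zero] with r hr
    simpa using hf r hr
  have top_of : ∀ f : ℝ → ℝ, (∀ r, 0 < r → |f r| ≤ C * r ^ 2) →
      f =O[atTop] fun r => r ^ 2 := fun f hf => by
    refine IsBigO.of_bound C ?_
    filter_upwards [eventually_gt_atTop 0] with r hr
    simpa using hf r hr
  refine ⟨HasDerivAt.contDiffOn_infty hder hs, hder, hd, ?_, zero_of _ b₁, zero_of _ b₂, ?_,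
    top_of _ b₁, top_of _ b₂⟩
  · refine IsBigO.of_bound C ?_
    filter_upwards [Ioo_mem_nhdsGT one_pos] with r hr
    have := hb r hr.1
    rw [max_eq_left hr.2.le, abs_of_nonpos (a := r - 1) (by linarith [hr.2])] at this
    simp only [norm_one, Real.norm_eq_abs]
    nlinarith [hr.1]
  · refine IsBigO.of_bound C ?_
    filter_upwards [eventually_ge_atTop 1] with r hr
    have := hb r (by linarith)
    rw [max_eq_right hr, abs_of_nonneg (a := r - 1) (by linarith)] at this
    rw [Real.norm_eq_abs, Real.norm_of_nonneg (by positivity)]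
    nlinarith [mul_nonneg hC (by linarith : (0 : ℝ) ≤ r)]

lemma one_isBigO_abs_log : (fun _ => (1 : ℝ)) =O[𝓝[>] 0] fun r => |Real.log r| :=
  (isLittleO_const_left.2 (Or.inr (by
    simpa [Function.comp_def] using
      tendsto_abs_atBot_atTop.comp Real.tendsto_log_nhdsGT_zero))).isBigO

lemma mul_abs_log_isBigO_one :
    (fun r => r * |Real.log r|) =O[𝓝[>] 0] fun _ => (1 : ℝ) := by
  refine ((isBigO_refl (fun r : ℝ => r) _).mul (isBigO_refl Real.log _).abs_left).trans ?_
  exact ((Real.continuous_mul_log.tendsto 0).mono_left nhdsWithin_le_nhds).isBigO_one ℝ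

lemma IsMultiplier.neg_sub_log {h h₁ h₂ : ℝ → ℝ} (hh : IsMultiplier (fun _ => 1) h h₁ h₂) (a : ℝ) :
    IsMultiplier (fun r => |Real.log r|) (fun r => -h r - a * Real.log r)
      (fun r => -h₁ r - a * r⁻¹) (fun r => -h₂ r + a / r ^ 2) := by
  have hlog := one_isBigO_abs_log
  have hsq : (fun _ => (1 : ℝ)) =O[atTop] fun r : ℝ => r ^ 2 := by
    simpa using isBigO_zpow_atTop (m := 0) (n := 2) (by norm_num)
  have e₁ : ∀ r : ℝ, 0 < r → r * (-h₁ r - a * r⁻¹) = -(r * h₁ r) - a * 1 := fun r hr => by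
    field_simp
  have e₂ : ∀ r : ℝ, 0 < r → r ^ 2 * (-h₂ r + a / r ^ 2) = -(r ^ 2 * h₂ r) + a * 1 :=
    fun r hr => by field_simp
  refine ⟨?_, fun r hr => ?_, fun r hr => ?_, ?_, ?_, ?_, ?_, ?_, ?_⟩
  · exact hh.smooth.neg.sub (contDiffOn_const.mul
      (contDiffOn_id.log fun r hr => ne_of_gt hr))
  · exact (hh.hasDerivAt r hr).neg.sub ((Real.hasDerivAt_log (ne_of_gt hr)).const_mul a)
  · refine ((hh.hasDerivAt' r hr).neg.sub
      ((hasDerivAt_inv (ne_of_gt hr)).const_mul a)).congr_deriv ?_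
    ring
  · exact (hh.zero.trans hlog).neg_left.sub
      (IsBigO.const_mul_left (isBigO_refl _ _).norm_right a)
  · refine ((hh.zero₁.trans hlog).neg_left.sub (hlog.const_mul_left a)).congr' ?_ .rfl
    filter_upwards [eventually_pos_nhdsGT_zero] with r hr using (e₁ r hr).symm
  · refine ((hh.zero₂.trans hlog).neg_left.add (hlog.const_mul_left a)).congr' ?_ .rfl
    filter_upwards [eventually_pos_nhdsGT_zero] with r hr using (e₂ r hr).symm
  · refine hh.top.neg_left.sub (IsBigO.const_mul_left (IsBigO.of_bound 1 ?_) a)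
    filter_upwards [eventually_ge_atTop 1] with r hr
    rw [Real.norm_of_nonneg (Real.log_nonneg hr), Real.norm_of_nonneg (by positivity)]
    nlinarith [Real.log_le_sub_one_of_pos (by linarith : 0 < r)]
  · refine (hh.top₁.neg_left.sub (hsq.const_mul_left a)).congr' ?_ .rfl
    filter_upwards [eventually_gt_atTop 0] with r hr using (e₁ r hr).symm
  · refine (hh.top₂.neg_left.add (hsq.const_mul_left a)).congr' ?_ .rfl
    filter_upwards [eventually_gt_atTop 0] with r hr using (e₂ r hr).symm

/-- The truncated mass `∫₀^r (ΛQ)² s ds`. -/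
def massQ (k : ℕ) (r : ℝ) : ℝ := ∫ s in (0 : ℝ)..r, LamQ k s ^ 2 * s

lemma hasDerivAt_massQ (k : ℕ) (r : ℝ) : HasDerivAt (massQ k) (LamQ k r ^ 2 * r) r :=
  ((((contDiff_LamQ k).continuous.pow 2).mul continuous_id).integral_hasStrictDerivAt
    0 r).hasDerivAt

lemma contDiffOn_massQ (k : ℕ) : ContDiffOn ℝ (⊤ : ℕ∞) (massQ k) (Ioi 0) :=
  HasDerivAt.contDiffOn_infty (fun r _ => hasDerivAt_massQ k r)
    (((contDiff_LamQ k).pow 2).mul contDiff_id).contDiffOn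

lemma massQ_nonneg (k : ℕ) {r : ℝ} (hr : 0 < r) : 0 ≤ massQ k r :=
  intervalIntegral.integral_nonneg hr.le fun _ hs => mul_nonneg (sq_nonneg _) hs.1

lemma massQ_le {k : ℕ} (hk : 0 < k) {r : ℝ} (hr : 0 < r) (hr1 : r ≤ 1) :
    massQ k r ≤ 4 * r ^ 2 * LamQ k r ^ 2 := by
  have hb : massQ k r ≤ 4 * k ^ 2 * (r ^ k) ^ 2 * r * |r - 0| := by
    refine (le_abs_self _).trans (intervalIntegral.norm_integral_le_of_norm_le_const
      (a := 0) (b := r) (f := fun s => LamQ k s ^ 2 * s) fun s hs => ?_)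
    rw [uIoc_of_le hr.le] at hs
    have h0 := hs.1
    have h1 := (LamQ_pos hk h0).le
    have h2 := LamQ_le_pow k h0
    rw [Real.norm_of_nonneg (by positivity)]
    calc LamQ k s ^ 2 * s ≤ (2 * k * s ^ k) ^ 2 * s := by gcongr
      _ ≤ (2 * k * r ^ k) ^ 2 * r := by gcongr <;> exact hs.2
      _ = _ := by ring
  have hl : k * r ^ k ≤ LamQ k r := by
    rw [LamQ, le_div_iff₀ (by positivity)]
    have : r ^ (2 * k) ≤ 1 := pow_le_one₀ hr.le hr1
    have : k * r ^ k * (1 + r ^ (2 * k)) ≤ k * r ^ k * 2 := by gcongr; linarith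
    linarith
  rw [sub_zero, abs_of_pos hr] at hb
  calc massQ k r ≤ 4 * r ^ 2 * (k * r ^ k) ^ 2 := by linarith
    _ ≤ _ := by gcongr

lemma integral_LamQ_sq_Ioi_le {k : ℕ} (hk : 2 ≤ k) {r : ℝ} (hr : 1 ≤ r) :
    ∫ s in Ioi r, LamQ k s ^ 2 * s ≤ 4 * r ^ 2 * LamQ k r ^ 2 := by
  have hr0 : 0 < r := by linarith
  have hk2 : (2 : ℝ) ≤ k := by exact_mod_cast hk
  have ha : (1 - 2 * k : ℝ) < -1 := by linarith
  have hpow : ∀ s : ℝ, 0 < s → s ^ (1 - 2 * k : ℝ) = s * ((s ^ k)⁻¹) ^ 2 := fun s hs => by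
    rw [Real.rpow_sub hs, Real.rpow_one, show (2 * k : ℝ) = ((k * 2 : ℕ) : ℝ) by push_cast; ring,
      Real.rpow_natCast, pow_mul, div_eq_mul_inv, inv_pow]
  have hb : ∫ s in Ioi r, LamQ k s ^ 2 * s ≤
      ∫ s in Ioi r, 4 * (k : ℝ) ^ 2 * s ^ (1 - 2 * k : ℝ) := by
    refine integral_mono_of_nonneg ?_ ((integrableOn_Ioi_rpow_of_lt ha hr0).const_mul _) ?_
    · filter_upwards [ae_restrict_mem measurableSet_Ioi] with s hs
      exact mul_nonneg (sq_nonneg _) (hr0.trans hs).le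
    · filter_upwards [ae_restrict_mem measurableSet_Ioi] with s hs
      have h0 : 0 < s := hr0.trans hs
      have h1 := (LamQ_pos (by lia : 0 < k) h0).le
      have h2 := LamQ_le_zpow k h0
      rw [zpow_neg, zpow_natCast] at h2
      rw [hpow s h0]
      calc LamQ k s ^ 2 * s ≤ (2 * k * (s ^ k)⁻¹) ^ 2 * s := by gcongr
        _ = _ := by ring
  rw [integral_const_mul, integral_Ioi_rpow_of_lt ha hr0, Real.rpow_add_one hr0.ne',
    hpow r hr0] at hb
  have hl : k * (r ^ k)⁻¹ ≤ LamQ k r := by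
    rw [LamQ, le_div_iff₀ (by positivity), mul_comm 2 k, pow_mul]
    have : 1 ≤ r ^ k := one_le_pow₀ hr
    have : (r ^ k)⁻¹ ≤ r ^ k := (inv_le_one_of_one_le₀ this).trans this
    have e : k * (r ^ k)⁻¹ * (1 + (r ^ k) ^ 2) = k * ((r ^ k)⁻¹ + r ^ k) := by field_simp
    rw [e, mul_comm (2 : ℝ), mul_assoc]
    gcongr
    linarith
  refine hb.trans ?_
  calc 4 * (k : ℝ) ^ 2 * (-(r * (r ^ k)⁻¹ ^ 2 * r) / (1 - 2 * k + 1))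
      = 4 * r ^ 2 * (k * (r ^ k)⁻¹) ^ 2 / (2 * k - 2) := by
        have : (0 : ℝ) < 2 * k - 2 := by linarith
        rw [show (1 - 2 * k + 1 : ℝ) = -(2 * k - 2) by ring, neg_div_neg_eq]
        ring
    _ ≤ 4 * r ^ 2 * (k * (r ^ k)⁻¹) ^ 2 := div_le_self (by positivity) (by linarith)
    _ ≤ _ := by gcongr

lemma gammaK_mul_massQ {k : ℕ} (hk : 2 ≤ k) {r : ℝ} (hr : 0 < r) :
    gammaK k * massQ k r = 8 * k ^ 2 - gammaK k * ∫ s in Ioi r, LamQ k s ^ 2 * s := by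
  have hi := integrableOn_LamQ_sq hk
  rw [← gammaK_mul_integral hk, massQ, ← intervalIntegral.integral_Ioi_sub_Ioi hi hr.le, mul_sub]

/-- `r h'` for the multiplier `h` with `B = h ΛQ`. -/
def multB (k : ℕ) (r : ℝ) : ℝ := -gammaK k * massQ k r / LamQ k r ^ 2 + 2 * r ^ (2 * k)

lemma contDiffOn_multB {k : ℕ} (hk : 0 < k) : ContDiffOn ℝ (⊤ : ℕ∞) (multB k) (Ioi 0) :=
  ((contDiffOn_const.mul (contDiffOn_massQ k)).div ((contDiff_LamQ k).pow 2).contDiffOn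
    fun _ hr => (pow_pos (LamQ_pos hk hr) 2).ne').add
    (contDiff_const.mul (contDiff_id.pow _)).contDiffOn

lemma hasDerivAt_multB {k : ℕ} (hk : 0 < k) {r : ℝ} (hr : 0 < r) :
    HasDerivAt (multB k) ((-(2 * k * cosQ k r) * multB k r - gammaK k * r ^ 2 +
      8 * k * (r ^ (2 * k) / (1 + r ^ (2 * k)))) / r) r := by
  have hΦ := LamQ_pos hk hr
  have h := (((hasDerivAt_massQ k r).const_mul (-gammaK k)).div ((hasDerivAt_LamQ hk hr).pow 2)
    (pow_pos hΦ 2).ne').add ((hasDerivAt_pow (2 * k) r).const_mul 2)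
  refine h.congr_deriv ?_
  have e : r ^ (2 * k) = r ^ (2 * k - 1) * r := by rw [← pow_succ]; congr 1; lia
  have hc : 8 * k * (r ^ (2 * k) / (1 + r ^ (2 * k))) = 4 * k * r ^ (2 * k) * (1 + cosQ k r) := by
    rw [cosQ]
    field_simp
    ring
  rw [hc, multB, e]
  simp only [Pi.pow_apply]
  push_cast
  field_simp
  ring

lemma abs_multB_le {k : ℕ} (hk : 2 ≤ k) {r : ℝ} (hr : 0 < r) :
    |multB k r| ≤ (4 * gammaK k + 6) * r ^ 2 := by
  have hγ : 0 ≤ gammaK k := by unfold gammaK; positivity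
  have hΦ := LamQ_pos (by lia : 0 < k) hr
  have h2 : 0 ≤ r ^ 2 := by positivity
  rcases le_total r 1 with h1 | h1
  · have hJ := massQ_le (by lia : 0 < k) hr h1
    have hJ0 := massQ_nonneg k hr
    have hv : r ^ (2 * k) ≤ r ^ 2 := pow_le_pow_of_le_one hr.le h1 (by lia)
    have hq : massQ k r / LamQ k r ^ 2 ≤ 4 * r ^ 2 := by rwa [div_le_iff₀ (by positivity)]
    have hq0 : 0 ≤ massQ k r / LamQ k r ^ 2 := by positivity
    have hv0 : 0 ≤ r ^ (2 * k) := by positivity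
    have e : multB k r = -(gammaK k * (massQ k r / LamQ k r ^ 2)) + 2 * r ^ (2 * k) := by
      rw [multB]; ring
    rw [e, abs_le]
    have := mul_le_mul_of_nonneg_left hq hγ
    have := mul_nonneg hγ hq0
    constructor <;> nlinarith
  · have hK := integral_LamQ_sq_Ioi_le hk h1
    have hK0 : 0 ≤ ∫ s in Ioi r, LamQ k s ^ 2 * s :=
      setIntegral_nonneg measurableSet_Ioi fun s hs => mul_nonneg (sq_nonneg _) (hr.trans hs).le
    have hq : (∫ s in Ioi r, LamQ k s ^ 2 * s) / LamQ k r ^ 2 ≤ 4 * r ^ 2 := by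
      rwa [div_le_iff₀ (by positivity)]
    have hq0 : 0 ≤ (∫ s in Ioi r, LamQ k s ^ 2 * s) / LamQ k r ^ 2 := by positivity
    have e : multB k r = gammaK k * ((∫ s in Ioi r, LamQ k s ^ 2 * s) / LamQ k r ^ 2)
        - (2 / r ^ (2 * k) + 4) := by
      have e1 : (8 * (k : ℝ) ^ 2) / LamQ k r ^ 2 = 2 * (1 + r ^ (2 * k)) ^ 2 / r ^ (2 * k) := by
        have : r ^ (2 * k) = (r ^ k) ^ 2 := by rw [mul_comm, pow_mul]
        rw [LamQ, this]
        field_simp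
        norm_num
      rw [multB, neg_mul, gammaK_mul_massQ hk hr, neg_sub, sub_div, e1]
      field_simp
      ring
    have hv : 2 / r ^ (2 * k) ≤ 2 := div_le_self (by norm_num) (one_le_pow₀ h1)
    have hv0 : 0 ≤ 2 / r ^ (2 * k) := by positivity
    have : 1 ≤ r ^ 2 := one_le_pow₀ h1
    rw [e, abs_le]
    have := mul_le_mul_of_nonneg_left hq hγ
    have := mul_nonneg hγ hq0
    constructor <;> nlinarith

lemma exists_isMultiplier_B {k : ℕ} (hk : 2 ≤ k) : ∃ h h₁ h₂ : ℝ → ℝ,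
    IsMultiplier (fun _ => 1) h h₁ h₂ ∧ ∀ r ∈ Ioi (0 : ℝ),
      (2 * k * cosQ k r + 1) * (r * h₁ r) + r ^ 2 * h₂ r =
        -gammaK k * r ^ 2 + 8 * k * (r ^ (2 * k) / (1 + r ^ (2 * k))) := by
  have hk0 : 0 < k := by lia
  have hγ : 0 ≤ gammaK k := by unfold gammaK; positivity
  set h₁ : ℝ → ℝ := fun r => multB k r / r with hh₁
  set h₂ : ℝ → ℝ := fun r => (-(2 * k * cosQ k r + 1) * multB k r - gammaK k * r ^ 2 +
      8 * k * (r ^ (2 * k) / (1 + r ^ (2 * k)))) / r ^ 2 with hh₂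
  set C := 4 * gammaK k + 6 with hC
  have hC0 : 0 ≤ C := by positivity
  refine ⟨_, h₁, h₂, IsMultiplier.of_bound (C := (2 * k + 1) * C + gammaK k + 8 * k) ?_ ?_ ?_ ?_,
    ?_⟩
  · exact (contDiffOn_multB hk0).div contDiffOn_id fun _ hr => ne_of_gt hr
  · intro r hr
    have hr0 : 0 < r := hr
    refine ((hasDerivAt_multB hk0 hr).div (hasDerivAt_id r) hr0.ne').congr_deriv ?_
    simp only [id, hh₂]
    field_simp
    ring
  · intro r hr
    have e : r * h₁ r = multB k r := by simp only [hh₁]; field_simp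
    rw [e]
    refine (abs_multB_le hk hr).trans ?_
    refine mul_le_mul_of_nonneg_right ?_ (sq_nonneg r)
    nlinarith [(Nat.cast_nonneg k : (0 : ℝ) ≤ k), mul_nonneg (Nat.cast_nonneg k : (0 : ℝ) ≤ k) hC0]
  · intro r hr
    have e : r ^ 2 * h₂ r = -((2 * k * cosQ k r + 1) * multB k r) - gammaK k * r ^ 2 +
      8 * k * (r ^ (2 * k) / (1 + r ^ (2 * k))) := by simp only [hh₂]; field_simp
    have hv0 : 0 < r ^ (2 * k) := by positivity
    have b1 : r ^ (2 * k) / (1 + r ^ (2 * k)) ≤ r ^ 2 := by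
      rcases le_total r 1 with h1 | h1
      · exact (div_le_self hv0.le (by linarith)).trans (pow_le_pow_of_le_one hr.le h1 (by lia))
      · exact ((div_le_one (by positivity)).2 (by linarith)).trans (one_le_pow₀ h1)
    have b2 : |2 * k * cosQ k r + 1| ≤ 2 * k + 1 := by
      have := abs_le.1 (abs_cosQ_le (k := k) hr)
      have hk' : (0 : ℝ) ≤ k := Nat.cast_nonneg k
      rw [abs_le]
      constructor <;> nlinarith
    calc |r ^ 2 * h₂ r| ≤ |2 * k * cosQ k r + 1| * |multB k r| + gammaK k * r ^ 2
          + 8 * k * (r ^ (2 * k) / (1 + r ^ (2 * k))) := by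
          rw [e]
          refine (abs_add_le _ _).trans (add_le_add ((abs_sub _ _).trans (add_le_add ?_ ?_)) ?_)
          · rw [abs_neg, abs_mul]
          · exact (abs_of_nonneg (by positivity)).le
          · exact (abs_of_nonneg (by positivity)).le
      _ ≤ (2 * k + 1) * (C * r ^ 2) + gammaK k * r ^ 2 + 8 * k * r ^ 2 := by
          gcongr
          exact abs_multB_le hk hr
      _ = _ := by ring
  · intro r hr
    have hr0 : 0 < r := hr
    simp only [hh₁, hh₂]
    field_simp
    ring

lemma exists_isProfile_A {k : ℕ} (hk : 4 ≤ k) :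
    ∃ A, IsProfile k (fun _ => 1) (fun r => -(Lam0V (LamQ k) r)) A := by
  have hm : IsMultiplier (fun _ => 1) (fun r => ∫ s in (1 : ℝ)..r, s / 2) (fun r => r / 2)
      (fun _ => 1 / 2) := by
    refine IsMultiplier.of_bound (C := 1) (by fun_prop) (fun r _ => (hasDerivAt_id r).div_const 2)
      (fun r hr => ?_) fun r hr => ?_ <;>
    · rw [abs_of_nonneg (by positivity)]
      nlinarith
  refine hm.exists_isProfile hk (isBigO_refl _ _) (by simpa using isBigO_pow_one (n := 1))
    fun r hr => ?_
  have hr0 : 0 < r := hr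
  rw [Lam0V, (hasDerivAt_LamQ (by lia : 0 < k) hr).deriv]
  field_simp
  ring

/-- existence of the profiles `A`, `B`, `B̃` solving
`L A = -Λ₀ΛQ`, `L B = γ_k ΛQ - 4 r^{k-2} (ΛQ)²`, `L B̃ = -γ_k ΛQ + 4 r^{-k-2} (ΛQ)²`
with orthogonality to `ΛQ`, the stated asymptotics at `0` and `∞`, and the
square-integrability of the profiles and their scaled versions. -/
theorem stmt2 (k : ℕ) (hk : 4 ≤ k) :
    ∃ A B Bt : ℝ → ℝ,
      ContDiffOn ℝ (⊤ : ℕ∞) A (Ioi 0) ∧ ContDiffOn ℝ (⊤ : ℕ∞) B (Ioi 0) ∧ ContDiffOn ℝ (⊤ : ℕ∞) Bt (Ioi 0) ∧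
      (∀ r ∈ Ioi (0 : ℝ), Lop k A r = -(Lam0V (LamQ k) r)) ∧
      (∀ r ∈ Ioi (0 : ℝ),
        Lop k B r = gammaK k * LamQ k r - 4 * r ^ (k - 2) * LamQ k r ^ 2) ∧
      (∀ r ∈ Ioi (0 : ℝ),
        Lop k Bt r = -(gammaK k) * LamQ k r + 4 * LamQ k r ^ 2 / r ^ (k + 2)) ∧
      (∫ r in Ioi (0 : ℝ), A r * LamQ k r * r) = 0 ∧
      (∫ r in Ioi (0 : ℝ), B r * LamQ k r * r) = 0 ∧
      (∫ r in Ioi (0 : ℝ), Bt r * LamQ k r * r) = 0 ∧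
      A =O[nhdsWithin 0 (Ioi 0)] (fun r : ℝ => r ^ k) ∧
      deriv A =O[nhdsWithin 0 (Ioi 0)] (fun r : ℝ => r ^ (k - 1)) ∧
      deriv (deriv A) =O[nhdsWithin 0 (Ioi 0)] (fun r : ℝ => r ^ (k - 2)) ∧
      B =O[nhdsWithin 0 (Ioi 0)] (fun r : ℝ => r ^ k) ∧
      deriv B =O[nhdsWithin 0 (Ioi 0)] (fun r : ℝ => r ^ (k - 1)) ∧
      deriv (deriv B) =O[nhdsWithin 0 (Ioi 0)] (fun r : ℝ => r ^ (k - 2)) ∧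
      Bt =O[nhdsWithin 0 (Ioi 0)] (fun r : ℝ => r ^ k * |Real.log r|) ∧
      deriv Bt =O[nhdsWithin 0 (Ioi 0)] (fun r : ℝ => r ^ (k - 1) * |Real.log r|) ∧
      deriv (deriv Bt) =O[nhdsWithin 0 (Ioi 0)] (fun r : ℝ => r ^ (k - 2) * |Real.log r|) ∧
      A =O[atTop] (fun r : ℝ => r ^ (2 - (k : ℤ))) ∧
      deriv A =O[atTop] (fun r : ℝ => r ^ (1 - (k : ℤ))) ∧
      deriv (deriv A) =O[atTop] (fun r : ℝ => r ^ (-(k : ℤ))) ∧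
      B =O[atTop] (fun r : ℝ => r ^ (2 - (k : ℤ))) ∧
      deriv B =O[atTop] (fun r : ℝ => r ^ (1 - (k : ℤ))) ∧
      deriv (deriv B) =O[atTop] (fun r : ℝ => r ^ (-(k : ℤ))) ∧
      Bt =O[atTop] (fun r : ℝ => r ^ (2 - (k : ℤ))) ∧
      deriv Bt =O[atTop] (fun r : ℝ => r ^ (1 - (k : ℤ))) ∧
      deriv (deriv Bt) =O[atTop] (fun r : ℝ => r ^ (-(k : ℤ))) ∧
      IntegrableOn (fun r => A r ^ 2 * r) (Ioi 0) ∧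
      IntegrableOn (fun r => LamV A r ^ 2 * r) (Ioi 0) ∧
      IntegrableOn (fun r => Lam0V (LamV A) r ^ 2 * r) (Ioi 0) ∧
      IntegrableOn (fun r => B r ^ 2 * r) (Ioi 0) ∧
      IntegrableOn (fun r => LamV B r ^ 2 * r) (Ioi 0) ∧
      IntegrableOn (fun r => Lam0V (LamV B) r ^ 2 * r) (Ioi 0) ∧
      IntegrableOn (fun r => Bt r ^ 2 * r) (Ioi 0) ∧
      IntegrableOn (fun r => LamV Bt r ^ 2 * r) (Ioi 0) ∧
      IntegrableOn (fun r => Lam0V (LamV Bt) r ^ 2 * r) (Ioi 0) := by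
  have hk0 : 0 < k := by lia
  obtain ⟨A, hA⟩ := exists_isProfile_A hk
  obtain ⟨h, h₁, h₂, hm, heq⟩ := exists_isMultiplier_B (by lia : 2 ≤ k)
  have hpow : ∀ r : ℝ, r ^ k = r ^ (k - 2) * r ^ 2 := fun r => by
    rw [← pow_add, Nat.sub_add_cancel (by lia)]
  have hpow' : ∀ r : ℝ, r ^ (2 * k) = (r ^ k) ^ 2 := fun r => by rw [mul_comm, pow_mul]
  obtain ⟨B, hB⟩ := hm.exists_isProfile hk (isBigO_refl _ _)
    (by simpa using isBigO_pow_one (n := 1))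
    (F := fun r => gammaK k * LamQ k r - 4 * r ^ (k - 2) * LamQ k r ^ 2) fun r hr => by
      have hr0 : 0 < r := hr
      rw [heq r hr]
      simp only [LamQ, hpow', hpow r]
      field_simp
      ring
  obtain ⟨Bt, hBt⟩ := (hm.neg_sub_log 4).exists_isProfile hk one_isBigO_abs_log
    mul_abs_log_isBigO_one
    (F := fun r => -(gammaK k) * LamQ k r + 4 * LamQ k r ^ 2 / r ^ (k + 2)) fun r hr => by
      have hr0 : 0 < r := hr
      have e : (2 * k * cosQ k r + 1) * (r * (-h₁ r - 4 * r⁻¹)) + r ^ 2 * (-h₂ r + 4 / r ^ 2)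
          = -((2 * k * cosQ k r + 1) * (r * h₁ r) + r ^ 2 * h₂ r) - 8 * k * cosQ k r := by
        field_simp
        ring
      rw [e, heq r hr]
      simp only [LamQ, cosQ, hpow', pow_add r k]
      field_simp
      ring
  exact ⟨A, B, Bt, hA.smooth, hB.smooth, hBt.smooth, hA.eqn, hB.eqn, hBt.eqn,
    hA.orthogonal, hB.orthogonal, hBt.orthogonal,
    by simpa using hA.zero, by simpa using hA.zero₁, by simpa using hA.zero₂,
    by simpa using hB.zero, by simpa using hB.zero₁, by simpa using hB.zero₂,
    hBt.zero, hBt.zero₁, hBt.zero₂, hA.top, hA.top₁, hA.top₂, hB.top, hB.top₁, hB.top₂,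
    hBt.top, hBt.top₁, hBt.top₂, hA.memL2, hA.memL2₁, hA.memL2₂, hB.memL2, hB.memL2₁, hB.memL2₂,
    hBt.memL2, hBt.memL2₁, hBt.memL2₂⟩

end
end

section
/- Let k ≥ 2 be an integer. There exists a constant C > 0 (depending only on k) with the following property. Let c, R > 0 and let p : (0,∞) → ℝ be five times continuously differentiable and satisfy, with Δg := g'' + g'/r: p(r) = r²/2 for r ≤ R; p is constant outside a bounded set; p''(r) ≥ -c and p'(r)/r ≥ -c for all r; |r (Δp)'(r)| ≤ c; Δ²p(r) ≤ c r^{-2}; Δ³p(r) ≥ -c r^{-4}; |r (p'(r)/r)'| ≤ c; and |r ( r (p'(r)/r)' )'| ≤ c for all r > 0. Define the truncated virial operator A₀w := (p''/2 + p'/(2r)) w + p' w'. Then for every w ∈ C_c^∞((0,∞)): ∫₀^∞ (A₀w)(r) · (L₀(L₀ w))(r) r dr ≥ -C c ∫₀^∞ (L₀w)(r)² r dr + 2 ∫₀^R (L₀w)(r)² r dr. -/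
open MeasureTheory Set Filter

noncomputable section

/-- The two-dimensional radial Laplacian `Δg(r) = g''(r) + g'(r)/r`. -/
def radLap (g : ℝ → ℝ) : ℝ → ℝ := fun r => deriv (deriv g) r + deriv g r / r

/-- The free operator `L₀ w = -w'' - w'/r + (k²/r²) w`. -/
def L0op (k : ℕ) (w : ℝ → ℝ) : ℝ → ℝ := fun r =>
  -deriv (deriv w) r - deriv w r / r + (k : ℝ) ^ 2 / r ^ 2 * w r


/-- If `v' = r h` with `|v| ≤ c`, `h ≤ c / r²` and `Δh ≥ -c / r⁴`, then `|h| ≤ 252 c / r²`. Only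
continuity of `deriv h` is needed: where `deriv h < -c / r³`, the bound on `Δh` forces `deriv h` to
be differentiable. -/
lemma abs_le_of_radLap_lower_bound {c : ℝ} (hc : 0 < c) {h v : ℝ → ℝ}
    (hh : ∀ r ∈ Ioi (0 : ℝ), HasDerivAt h (deriv h r) r)
    (hu : ContinuousOn (deriv h) (Ioi 0))
    (hv : ∀ r ∈ Ioi (0 : ℝ), HasDerivAt v (r * h r) r)
    (hvc : ∀ r ∈ Ioi (0 : ℝ), |v r| ≤ c)
    (hup : ∀ r ∈ Ioi (0 : ℝ), h r ≤ c / r ^ 2)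
    (hlow : ∀ r ∈ Ioi (0 : ℝ), -(c / r ^ 4) ≤ radLap h r) :
    ∀ r ∈ Ioi (0 : ℝ), |h r| ≤ 252 * c / r ^ 2 := by
  have hdiff : ∀ t, 0 < t → deriv h t < -(c / t ^ 3) →
      DifferentiableAt ℝ (deriv h) t := by
    intro t ht hlt
    by_contra hnd
    have h1 := hlow t ht
    simp only [radLap, deriv_zero_of_not_differentiableAt hnd, zero_add] at h1
    have h2 : -(c / t ^ 4) * t ≤ deriv h t := by rwa [le_div_iff₀ ht] at h1
    have h3 : -(c / t ^ 4) * t = -(c / t ^ 3) := by field_simp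
    linarith
  have mvt : ∀ {F F' : ℝ → ℝ} {x y : ℝ}, 0 < x → x < y →
      (∀ r ∈ Ioi (0 : ℝ), HasDerivAt F (F' r) r) →
      ∃ t, x < t ∧ t < y ∧ F y - F x = F' t * (y - x) := by
    intro F F' x y hx hxy hF
    obtain ⟨t, ht, h1⟩ := exists_hasDerivAt_eq_slope F F' hxy
      (fun s hs => (hF s (hx.trans_le hs.1)).continuousAt.continuousWithinAt)
      (fun s hs => hF s (hx.trans hs.1))
    refine ⟨t, ht.1, ht.2, ?_⟩
    rw [h1, div_mul_cancel₀ _ (sub_pos.2 hxy).ne']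
  have mean : ∀ {x y : ℝ}, 0 < x → x < y →
      ∃ t, x < t ∧ t < y ∧ -(2 * c) ≤ t * h t * (y - x) := by
    intro x y hx hxy
    obtain ⟨t, h1, h2, h3⟩ := mvt hx hxy hv
    refine ⟨t, h1, h2, ?_⟩
    have := abs_le.1 (hvc x hx)
    have := abs_le.1 (hvc y (hx.trans hxy))
    linarith [this.1]
  have hder : ∀ r, 0 < r → -(61 * c) ≤ r ^ 3 * deriv h r := by
    intro r hr
    by_contra! hlt
    set X := c / r ^ 2 with hX
    have hX0 : 0 < X := by positivity
    have hinv : ∀ s, r / 2 ≤ s → c / s ^ 2 ≤ 4 * X := by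
      intro s hs
      have hs0 : 0 < s := by linarith
      rw [hX, ← mul_div_assoc, div_le_div_iff₀ (by positivity) (by positivity)]
      have h1 : r ^ 2 ≤ 4 * s ^ 2 := by nlinarith
      nlinarith [mul_le_mul_of_nonneg_left h1 hc.le]
    have step : ∀ s, r / 2 ≤ s → s ≤ r → (∀ t ∈ Ioo s r, deriv h t < -(c / t ^ 3)) →
        s * deriv h s ≤ -(59 * X) := by
      intro s hs hsr hneg
      have hs0 : 0 < s := by linarith
      have hmono : MonotoneOn (fun t => t * deriv h t - c / (2 * t ^ 2)) (Icc s r) := by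
        apply monotoneOn_of_hasDerivWithinAt_nonneg (convex_Icc s r)
          (f' := fun t => deriv h t + t * deriv (deriv h) t + c / t ^ 3)
        · have h2 : ContinuousOn (deriv h) (Icc s r) :=
            hu.mono fun x hx => hs0.trans_le hx.1
          refine ContinuousOn.sub (continuousOn_id.mul h2)
            (ContinuousOn.div continuousOn_const (by fun_prop) ?_)
          intro x hx
          have : 0 < x := hs0.trans_le hx.1
          positivity
        · intro t ht
          rw [interior_Icc] at ht
          have ht0 : 0 < t := hs0.trans ht.1
          have hd := (hdiff t ht0 (hneg t ht)).hasDerivAt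
          have h3 := ((hasDerivAt_id' t).mul hd).sub
            ((hasDerivAt_const t c).div ((hasDerivAt_pow 2 t).const_mul 2) (by positivity))
          refine HasDerivAt.hasDerivWithinAt (h3.congr_deriv ?_)
          push_cast
          field_simp
          ring
        · intro t ht
          rw [interior_Icc] at ht
          have ht0 : 0 < t := hs0.trans ht.1
          have h1 := hlow t ht0
          simp only [radLap] at h1
          have h2 := mul_le_mul_of_nonneg_left h1 ht0.le
          have h3 : t * (deriv (deriv h) t + deriv h t / t)
              = t * deriv (deriv h) t + deriv h t := by field_simp
          have h4 : t * -(c / t ^ 4) = -(c / t ^ 3) := by field_simp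
          linarith
      have h1 : s * deriv h s - c / (2 * s ^ 2) ≤ r * deriv h r - c / (2 * r ^ 2) :=
        hmono ⟨le_rfl, hsr⟩ ⟨hsr, le_rfl⟩ hsr
      have h5 : r * deriv h r < -(61 * X) := by
        have : r * deriv h r = r ^ 3 * deriv h r / r ^ 2 := by field_simp
        rw [this, hX, ← mul_div_assoc, ← neg_div]
        gcongr
      have h6 : c / (2 * s ^ 2) = c / s ^ 2 / 2 := by field_simp
      have h7 : c / (2 * r ^ 2) = X / 2 := by rw [hX]; field_simp
      linarith [hinv s hs]
    have key : ∀ s ∈ Icc (r / 2) r, deriv h s < -(c / s ^ 3) := by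
      by_contra! hex
      obtain ⟨s₀, hs₀, hs₀'⟩ := hex
      set S : Set ℝ := {s ∈ Icc (r / 2) r | -(c / s ^ 3) ≤ deriv h s} with hS
      have hpos : ∀ x ∈ Icc (r / 2) r, 0 < x := fun x hx => by linarith [hx.1]
      have hcl : IsClosed S := by
        refine isClosed_Icc.isClosed_le (ContinuousOn.neg (ContinuousOn.div continuousOn_const
          (by fun_prop) fun x hx => ?_)) (hu.mono hpos)
        have := hpos x hx
        positivity
      have hcomp : IsCompact S := isCompact_Icc.of_isClosed_subset hcl fun x hx => hx.1
      obtain ⟨s, hsS, hsmax⟩ := hcomp.exists_isGreatest ⟨s₀, hs₀, hs₀'⟩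
      have hs0 : 0 < s := hpos s hsS.1
      have h1 := step s hsS.1.1 hsS.1.2 fun t ht => by
        by_contra! hge
        exact absurd (hsmax ⟨⟨hsS.1.1.trans ht.1.le, ht.2.le⟩, hge⟩) (not_le.2 ht.1)
      have h2 : s * -(c / s ^ 3) ≤ s * deriv h s := mul_le_mul_of_nonneg_left hsS.2 hs0.le
      have h3 : s * -(c / s ^ 3) = -(c / s ^ 2) := by field_simp
      linarith [hinv s hsS.1.1]
    obtain ⟨t, ht1, ht2, ht3⟩ := mean (x := 3 * r / 4) (y := r) (by positivity) (by linarith)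
    obtain ⟨s, hs1, hs2, hs3⟩ := mvt (x := r / 2) (y := t) (by positivity) (by linarith) hh
    have h1 := step s hs1.le (hs2.trans ht2).le fun x hx =>
      key x ⟨hs1.le.trans hx.1.le, hx.2.le⟩
    have h2 := (hup (r / 2) (half_pos hr)).trans (hinv _ le_rfl)
    have hs0 : 0 < s := by linarith
    have h3 : deriv h s * r ≤ -(59 * X) := by
      have : deriv h s < 0 := by
        by_contra! h0
        nlinarith
      nlinarith
    have h4 : h t - h (r / 2) ≤ -(59 / 4 * X) := by
      rw [hs3]
      have : deriv h s < 0 := by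
        by_contra! h0
        nlinarith
      nlinarith
    have hcX : c = X * r ^ 2 := by rw [hX]; field_simp
    have h5 : -(8 * X * r) ≤ t * h t := by
      have : -(8 * X * r) * (r / 4) ≤ t * h t * (r / 4) := by
        rw [hcX] at ht3
        linarith
      exact le_of_mul_le_mul_right this (by positivity)
    have h6 : h t ≤ -(43 / 4 * X) := by linarith
    have h7 : t * h t ≤ t * -(43 / 4 * X) := mul_le_mul_of_nonneg_left h6 (by linarith)
    nlinarith
  intro r hr
  have hr : 0 < r := hr
  set X := c / r ^ 2 with hX
  have hX0 : 0 < X := by positivity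
  have hcX : c = X * r ^ 2 := by rw [hX]; field_simp
  rw [mul_div_assoc, ← hX, abs_le]
  refine ⟨?_, by linarith [hup r hr]⟩
  obtain ⟨t, ht1, ht2, ht3⟩ := mean (x := r / 2) (y := r) (by positivity) (by linarith)
  obtain ⟨s, hs1, hs2, hs3⟩ := mvt (x := t) (y := r) (by linarith) ht2 hh
  have h5 : -(4 * X * r) ≤ t * h t := by
    have : -(4 * X * r) * (r / 2) ≤ t * h t * (r / 2) := by
      rw [hcX] at ht3
      linarith
    exact le_of_mul_le_mul_right this (by positivity)
  have h6 : -(8 * X) ≤ h t := by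
    by_contra! h0
    have : t * h t < t * -(8 * X) := mul_lt_mul_of_pos_left h0 (by linarith)
    nlinarith
  have h7 : -(488 * X) ≤ r * deriv h s := by
    by_contra! h0
    have h1 := hder s (by linarith)
    have h2 : r ^ 3 ≤ 8 * s ^ 3 := by
      have := pow_le_pow_left₀ (half_pos hr).le (ht1.trans hs1).le 3
      nlinarith
    have h3 : r * (s ^ 3 * deriv h s) < s ^ 3 * -(488 * X) := by
      have : 0 < s ^ 3 := pow_pos (by linarith) 3
      nlinarith
    rw [hcX] at h1
    have h4 := mul_le_mul_of_nonneg_left h1 hr.le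
    have h5 := mul_le_mul_of_nonneg_left h2 hX0.le
    nlinarith
  have h8 : -(244 * X) ≤ deriv h s * (r - t) := by
    rcases le_total 0 (deriv h s) with h0 | h0
    · have : 0 ≤ deriv h s * (r - t) := mul_nonneg h0 (by linarith)
      linarith
    · nlinarith
  linarith

lemma two_mul_mul_le_of_abs_le {β c x y : ℝ} (h : |β| ≤ c) :
    2 * (β * x * y) ≤ c * (x ^ 2 + y ^ 2) := by
  obtain ⟨h1, h2⟩ := abs_le.1 h
  nlinarith [mul_nonneg (sub_nonneg.2 h2) (sq_nonneg (x + y)),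
    mul_nonneg (neg_le_iff_add_nonneg.1 h1) (sq_nonneg (x - y))]

/-- The density controlling `(w'')² + (w'/r)² + (w/r²)²` in the elliptic estimate for `L₀`, as a
function of `r`, `κ = k²` and the values of `w, w', w''`. -/
def ellipticDensity (κ r w w₁ w₂ : ℝ) : ℝ :=
  ((r * w₂ - w₁ + w / r) ^ 2 + (2 * κ + 2) * (w₁ - w / r) ^ 2 + (κ - 1) ^ 2 * (w / r) ^ 2) / r

/-- The density `f [L₀, A₀]w + (A₀ f) f`, up to a total derivative, where `f = L₀ w`, `a = p'`,
`D₁ = (Δp)'` and `h = Δ²p`. -/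
def commutatorDensity (κ r a a₁ D₁ h f w w₁ w₂ : ℝ) : ℝ :=
  f * (-2 * D₁ * w₁ - h * w / 2 - 2 * a₁ * w₂ + 2 * (a / r) * (κ * w / r ^ 2 - w₁ / r)) * r

lemma commutatorDensity_lower_bound {κ r c a a₁ D₁ h f w w₁ w₂ : ℝ} (hκ : 4 ≤ κ) (hr : 0 < r)
    (hc : 0 < c) (hf : f = -w₂ - w₁ / r + κ / r ^ 2 * w)
    (hβ : |a₁ - a / r| ≤ c) (hD : |r * D₁| ≤ c) (hh : |h| ≤ 252 * c / r ^ 2) :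
    2 * (a / r) * (f ^ 2 * r) - 65 * c * (f ^ 2 * r) - 8 * c * ellipticDensity κ r w w₁ w₂
      ≤ commutatorDensity κ r a a₁ D₁ h f w w₁ w₂ := by
  have hH : |h * r ^ 2 / 4| ≤ 63 * c := by
    rw [abs_div, abs_mul, abs_of_pos (by positivity : 0 < r ^ 2),
      abs_of_pos (by norm_num : (0:ℝ) < 4)]
    rw [le_div_iff₀ (by positivity)] at hh
    linarith
  have h1 := two_mul_mul_le_of_abs_le (x := r * w₂) (y := r * f) hβ
  have h2 := two_mul_mul_le_of_abs_le (x := w₁) (y := r * f) hD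
  have h3 := two_mul_mul_le_of_abs_le (x := w / r) (y := r * f) hH
  have h4 : (r * w₂) ^ 2 + w₁ ^ 2 + 63 * (w / r) ^ 2 ≤ 8 * ((r * w₂ - w₁ + w / r) ^ 2
      + (2 * κ + 2) * (w₁ - w / r) ^ 2 + (κ - 1) ^ 2 * (w / r) ^ 2) := by
    set z := w / r
    set x := w₁ - z with hx
    set y := r * w₂ - w₁ + z with hy
    have e1 : w₁ = x + z := by rw [hx]; ring
    have e2 : r * w₂ = y + x := by rw [hy, hx]; ring
    rw [e2, e1]
    have e3 : 10 * x ^ 2 ≤ (2 * κ + 2) * x ^ 2 := by gcongr; linarith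
    have e4 : 9 * z ^ 2 ≤ (κ - 1) ^ 2 * z ^ 2 := by gcongr; nlinarith
    nlinarith [sq_nonneg (y - x), sq_nonneg (x - z), sq_nonneg x, sq_nonneg y, sq_nonneg z]
  have h5 := mul_le_mul_of_nonneg_left h4 hc.le
  have e : commutatorDensity κ r a a₁ D₁ h f w w₁ w₂ = (2 * (a / r) * (r * f) ^ 2
      - 2 * ((a₁ - a / r) * (r * w₂) * (r * f)) - 2 * (r * D₁ * w₁ * (r * f))
      - 2 * (h * r ^ 2 / 4 * (w / r) * (r * f))) / r := by
    have : κ * w / r ^ 2 - w₁ / r = f + w₂ := by rw [hf]; ring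
    rw [commutatorDensity, this]
    field_simp
    ring
  have e' : 2 * (a / r) * (f ^ 2 * r) - 65 * c * (f ^ 2 * r)
      - 8 * c * ellipticDensity κ r w w₁ w₂ = (2 * (a / r) * (r * f) ^ 2 - 65 * c * (r * f) ^ 2
      - 8 * c * ((r * w₂ - w₁ + w / r) ^ 2
      + (2 * κ + 2) * (w₁ - w / r) ^ 2 + (κ - 1) ^ 2 * (w / r) ^ 2)) / r := by
    rw [ellipticDensity]
    field_simp
  rw [e, e']
  gcongr ?_ / r
  linarith

/-- The difference between `f² r` and the elliptic density is a total derivative. -/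
lemma hasDerivAt_elliptic {κ r w₂ : ℝ} {w w₁ : ℝ → ℝ} (hr : 0 < r)
    (hw : HasDerivAt w (w₁ r) r) (hw₁ : HasDerivAt w₁ w₂ r) :
    HasDerivAt (fun s => 2 * (w₁ s - w s / s) ^ 2
        - 2 * (κ - 1) * (w s / s) * (w₁ s - w s / s) - 2 * (κ - 1) * (w s / s) ^ 2)
      ((-w₂ - w₁ r / r + κ / r ^ 2 * w r) ^ 2 * r - ellipticDensity κ r (w r) (w₁ r) w₂) r := by
  have hz := hw.div (hasDerivAt_id' r) hr.ne'
  have hx := hw₁.sub hz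
  have := (((hx.pow 2).const_mul 2).sub ((hz.const_mul (2 * (κ - 1))).mul hx)).sub
    ((hz.pow 2).const_mul (2 * (κ - 1)))
  refine this.congr_deriv ?_
  simp only [Pi.sub_apply, Pi.div_apply, ellipticDensity, Nat.add_one_sub_one, pow_one,
    Nat.cast_ofNat]
  field_simp
  ring

/-- The virial density minus the commutator density is a total derivative. -/
lemma hasDerivAt_virial {κ r D₂ f₂ w₃ : ℝ} {a a₁ D D₁ f f₁ w w₁ w₂ : ℝ → ℝ} (hr : 0 < r)
    (ha : HasDerivAt a (a₁ r) r) (hDa : D = fun s => a₁ s + a s / s)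
    (hD : HasDerivAt D (D₁ r) r) (hD₁ : HasDerivAt D₁ D₂ r)
    (hf : HasDerivAt f (f₁ r) r) (hf₁ : HasDerivAt f₁ f₂ r)
    (hw : HasDerivAt w (w₁ r) r) (hw₁ : HasDerivAt w₁ (w₂ r) r) (hw₂ : HasDerivAt w₂ w₃ r)
    (hfw : f = fun s => -w₂ s - w₁ s / s + κ / s ^ 2 * w s) :
    HasDerivAt (fun s => s * (f s * (D₁ s / 2 * w s + D s / 2 * w₁ s + a₁ s * w₁ s + a s * w₂ s)
        - f₁ s * (D s / 2 * w s + a s * w₁ s)) + s * a s * f s ^ 2 / 2)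
      ((D r / 2 * w r + a r * w₁ r) * (-f₂ - f₁ r / r + κ / r ^ 2 * f r) * r
        - commutatorDensity κ r (a r) (a₁ r) (D₁ r) (D₂ + D₁ r / r) (f r) (w r) (w₁ r) (w₂ r))
      r := by
  have hid := hasDerivAt_id' r
  have hae := ha.div hid hr.ne'
  have ha₁ : HasDerivAt a₁ (D₁ r - (a₁ r * r - a r) / r ^ 2) r := by
    have h1 := hD.sub hae
    have h2 : D - a / (fun s => s) = a₁ := by
      rw [hDa]; ext s; simp
    rw [h2] at h1
    exact h1.congr_deriv (by ring)
  have hf' : f₁ r = -w₃ - (w₂ r * r - w₁ r) / r ^ 2 + κ / r ^ 2 * w₁ r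
      - 2 * κ / r ^ 3 * w r := by
    have h1 := (hw₂.neg.sub (hw₁.div hid hr.ne')).add
      (((hasDerivAt_const r κ).div (hasDerivAt_pow 2 r) (by positivity)).mul hw)
    have h2 : f = (-w₂ - w₁ / fun x => x) + ((fun _ => κ) / fun x => x ^ 2) * w := hfw
    rw [← h2] at h1
    rw [hf.unique h1]
    push_cast
    simp
    field_simp
    ring
  have hg := (hD.div_const 2).mul hw |>.add (ha.mul hw₁)
  have hg₁ := (((hD₁.div_const 2).mul hw).add ((hD.div_const 2).mul hw₁)).add (ha₁.mul hw₁)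
    |>.add (ha.mul hw₂)
  have := (hid.mul ((hf.mul hg₁).sub (hf₁.mul hg))).add
    (((hid.mul ha).mul (hf.pow 2)).div_const 2)
  refine this.congr_deriv ?_
  have hDr : D r = a₁ r + a r / r := by rw [hDa]
  have hfr : w₂ r = - w₁ r / r + κ / r ^ 2 * w r - f r := by rw [hfw]; ring
  have hw3 : w₃ = - (w₂ r * r - w₁ r) / r ^ 2 + κ / r ^ 2 * w₁ r
      - 2 * κ / r ^ 3 * w r - f₁ r := by rw [hf']; ring
  simp only [Pi.add_apply, Pi.mul_apply, Pi.sub_apply, Pi.pow_apply,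
    commutatorDensity]
  rw [hw3, hfr, hDr]
  field_simp
  ring

lemma ContDiffOn.hasDerivAt_of_pos {f : ℝ → ℝ} {n : WithTop ℕ∞} (hf : ContDiffOn ℝ n f (Ioi 0))
    (hn : n ≠ 0) {r : ℝ} (hr : 0 < r) : HasDerivAt f (deriv f r) r :=
  ((hf.differentiableOn hn).differentiableAt (Ioi_mem_nhds hr)).hasDerivAt

lemma ContDiffOn.radLap {f : ℝ → ℝ} {m n : WithTop ℕ∞} (hf : ContDiffOn ℝ n f (Ioi 0))
    (hmn : m + 1 + 1 ≤ n) : ContDiffOn ℝ m (radLap f) (Ioi 0) := by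
  have h1 : ContDiffOn ℝ (m + 1) (deriv f) (Ioi 0) := hf.deriv_of_isOpen isOpen_Ioi hmn
  exact (h1.deriv_of_isOpen isOpen_Ioi le_rfl).add
    ((h1.of_le le_self_add).div contDiffOn_id fun x hx => (mem_Ioi.1 hx).ne')

lemma ContDiffOn.L0op {w : ℝ → ℝ} (k : ℕ) (hw : ContDiffOn ℝ (⊤ : ℕ∞) w (Ioi 0)) :
    ContDiffOn ℝ (⊤ : ℕ∞) (L0op k w) (Ioi 0) := by
  have h1 : ContDiffOn ℝ (⊤ : ℕ∞) (deriv w) (Ioi 0) := hw.deriv_of_isOpen isOpen_Ioi (by simp)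
  have h2 : ContDiffOn ℝ (⊤ : ℕ∞) (deriv (deriv w)) (Ioi 0) :=
    h1.deriv_of_isOpen isOpen_Ioi (by simp)
  exact (h2.neg.sub (h1.div contDiffOn_id fun x hx => (mem_Ioi.1 hx).ne')).add
    ((contDiffOn_const.div (contDiffOn_id.pow 2) fun x hx =>
      pow_ne_zero 2 (mem_Ioi.1 hx).ne').mul hw)

lemma L0op_eventuallyEq_zero {w : ℝ → ℝ} {x : ℝ} (k : ℕ) (h : w =ᶠ[nhds x] 0) :
    L0op k w =ᶠ[nhds x] 0 := by
  have h1 := h.deriv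
  filter_upwards [h, h1, h1.deriv] with y h0 h1 h2
  simp [L0op, h0, h1, h2, Pi.zero_def]

/-- A compact subset of `(0, ∞)` lies in a compact subinterval. -/
lemma IsCompact.exists_subset_Ioo_of_pos {K : Set ℝ} (hK : IsCompact K) (h : K ⊆ Ioi 0) :
    ∃ α β : ℝ, 0 < α ∧ α < β ∧ K ⊆ Ioo α β := by
  rcases K.eq_empty_or_nonempty with rfl | hne
  · exact ⟨1, 2, by norm_num, by norm_num, empty_subset _⟩
  · obtain ⟨a, ha, hamin⟩ := hK.exists_isLeast hne
    obtain ⟨b, hb, hbmax⟩ := hK.exists_isGreatest hne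
    have ha0 : 0 < a := h ha
    have hab : a ≤ b := hamin hb
    exact ⟨a / 2, b + 1, by positivity, by linarith, fun x hx =>
      ⟨by linarith [hamin hx], by linarith [hbmax hx]⟩⟩

lemma setIntegral_Ioi_eq_intervalIntegral {φ : ℝ → ℝ} {α β : ℝ} (hα : 0 ≤ α) (hαβ : α ≤ β)
    (h : ∀ x ∉ Ioo α β, φ x = 0) : ∫ r in Ioi (0 : ℝ), φ r = ∫ r in α..β, φ r := by
  rw [intervalIntegral.integral_of_le hαβ]
  exact setIntegral_eq_of_subset_of_forall_sdiff_eq_zero measurableSet_Ioi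
    (fun x hx => hα.trans_lt hx.1) fun x hx => h x fun hx' => hx.2 ⟨hx'.1, hx'.2.le⟩

/-- the Pohozaev-type coercivity estimate
`⟨A₀w | L₀²w⟩ ≥ -Cc ‖w‖_{H²}² + 2∫₀^R (L₀w)² r dr` for the truncated virial
operator `A₀w = (p''/2 + p'/(2r)) w + p' w'`. -/
theorem stmt9 (k : ℕ) (hk : 2 ≤ k) :
    ∃ C : ℝ, 0 < C ∧
      ∀ c R : ℝ, 0 < c → 0 < R →
      ∀ p : ℝ → ℝ,
        ContDiffOn ℝ 5 p (Ioi 0) →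
        (∀ r ∈ Ioc (0 : ℝ) R, p r = r ^ 2 / 2) →
        (∃ Rt : ℝ, ∀ r ∈ Ici Rt, p r = p Rt) →
        (∀ r ∈ Ioi (0 : ℝ), -c ≤ deriv (deriv p) r) →
        (∀ r ∈ Ioi (0 : ℝ), -c ≤ deriv p r / r) →
        (∀ r ∈ Ioi (0 : ℝ), |r * deriv (radLap p) r| ≤ c) →
        (∀ r ∈ Ioi (0 : ℝ), radLap (radLap p) r ≤ c / r ^ 2) →
        (∀ r ∈ Ioi (0 : ℝ), -(c / r ^ 4) ≤ radLap (radLap (radLap p)) r) →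
        (∀ r ∈ Ioi (0 : ℝ), |r * deriv (fun s => deriv p s / s) r| ≤ c) →
        (∀ r ∈ Ioi (0 : ℝ),
          |r * deriv (fun s => s * deriv (fun u => deriv p u / u) s) r| ≤ c) →
      ∀ w : ℝ → ℝ, ContDiff ℝ (⊤ : ℕ∞) w → HasCompactSupport w → tsupport w ⊆ Ioi 0 →
        (∫ r in Ioi (0 : ℝ),
            ((deriv (deriv p) r / 2 + deriv p r / (2 * r)) * w r + deriv p r * deriv w r)
              * L0op k (L0op k w) r * r)
          ≥ -(C * c) * (∫ r in Ioi (0 : ℝ), L0op k w r ^ 2 * r)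
            + 2 * ∫ r in Ioc (0 : ℝ) R, L0op k w r ^ 2 * r := by
  set κ : ℝ := (k : ℝ) ^ 2 with hκ
  have hκ4 : 4 ≤ κ := by
    have : (2 : ℝ) ≤ k := by exact_mod_cast hk
    nlinarith
  refine ⟨75, by norm_num, ?_⟩
  intro c R hc hR p hp hpR _ _ hb hD hbi htri hβ _ w hw hws hwt
  -- the functions built from `p`
  set a : ℝ → ℝ := deriv p with ha_def
  set a₁ : ℝ → ℝ := deriv a with ha₁_def
  set D : ℝ → ℝ := radLap p with hD_def
  set D₁ : ℝ → ℝ := deriv D with hD₁_def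
  set h : ℝ → ℝ := radLap D with hh_def
  have sa : ContDiffOn ℝ 4 a (Ioi 0) := hp.deriv_of_isOpen isOpen_Ioi (by norm_num)
  have sa₁ : ContDiffOn ℝ 3 a₁ (Ioi 0) := sa.deriv_of_isOpen isOpen_Ioi (by norm_num)
  have sD : ContDiffOn ℝ 3 D (Ioi 0) := hp.radLap (by norm_num)
  have sD₁ : ContDiffOn ℝ 2 D₁ (Ioi 0) := sD.deriv_of_isOpen isOpen_Ioi (by norm_num)
  have sh : ContDiffOn ℝ 1 h (Ioi 0) := sD.radLap (by norm_num)
  have sh₁ : ContinuousOn (deriv h) (Ioi 0) := sh.continuousOn_deriv_of_isOpen isOpen_Ioi le_rfl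
  have hh : ∀ r ∈ Ioi (0 : ℝ), |h r| ≤ 252 * c / r ^ 2 := by
    refine abs_le_of_radLap_lower_bound (v := fun r => r * D₁ r) hc
      (fun r hr => sh.hasDerivAt_of_pos (by norm_num) hr) sh₁ (fun r hr => ?_) hD hbi htri
    have hr : 0 < r := hr
    refine ((hasDerivAt_id' r).mul (sD₁.hasDerivAt_of_pos (by norm_num) hr)).congr_deriv ?_
    rw [hh_def, radLap]
    field_simp
    ring
  have hβ' : ∀ r, 0 < r → |a₁ r - a r / r| ≤ c := by
    intro r hr
    have h1 := hβ r hr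
    have h2 := (sa.hasDerivAt_of_pos (by norm_num) hr).div (hasDerivAt_id' r) hr.ne'
    have h3 : deriv (fun s => a s / s) r = _ := h2.deriv
    rw [h3] at h1
    convert h1 using 2
    rw [← ha₁_def]
    field_simp
  -- the functions built from `w`
  set w₁ : ℝ → ℝ := deriv w with hw₁_def
  set w₂ : ℝ → ℝ := deriv w₁ with hw₂_def
  set f : ℝ → ℝ := L0op k w with hf_def
  set f₁ : ℝ → ℝ := deriv f with hf₁_def
  have sw₁ : ContDiff ℝ (⊤ : ℕ∞) w₁ := hw.deriv'
  have sw₂ : ContDiff ℝ (⊤ : ℕ∞) w₂ := sw₁.deriv'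
  have sf : ContDiffOn ℝ (⊤ : ℕ∞) f (Ioi 0) := hw.contDiffOn.L0op k
  have sf₁ : ContDiffOn ℝ (⊤ : ℕ∞) f₁ (Ioi 0) := sf.deriv_of_isOpen isOpen_Ioi (by simp)
  have sLf : ContinuousOn (L0op k f) (Ioi 0) := (sf.L0op k).continuousOn
  have dw : ∀ r, HasDerivAt w (w₁ r) r := fun r => (hw.differentiable (by simp) r).hasDerivAt
  have dw₁ : ∀ r, HasDerivAt w₁ (w₂ r) r := fun r => (sw₁.differentiable (by simp) r).hasDerivAt
  have dw₂ : ∀ r, HasDerivAt w₂ (deriv w₂ r) r :=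
    fun r => (sw₂.differentiable (by simp) r).hasDerivAt
  obtain ⟨α, β, hα, hαβ, hsub⟩ := IsCompact.exists_subset_Ioo_of_pos hws hwt
  have hev : ∀ x ∉ Ioo α β, w =ᶠ[nhds x] 0 := fun x hx =>
    notMem_tsupport_iff_eventuallyEq.1 fun h' => hx (hsub h')
  have zw : ∀ x ∉ Ioo α β, w x = 0 := fun x hx => (hev x hx).eq_of_nhds
  have zw₁ : ∀ x ∉ Ioo α β, w₁ x = 0 := fun x hx => by
    simpa [Pi.zero_def] using (hev x hx).deriv.eq_of_nhds
  have zf : ∀ x ∉ Ioo α β, f x = 0 := fun x hx => (L0op_eventuallyEq_zero k (hev x hx)).eq_of_nhds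
  have zf₁ : ∀ x ∉ Ioo α β, f₁ x = 0 := fun x hx => by
    simpa [Pi.zero_def] using (L0op_eventuallyEq_zero k (hev x hx)).deriv.eq_of_nhds
  have hαn : α ∉ Ioo α β := fun hx => lt_irrefl _ hx.1
  have hβn : β ∉ Ioo α β := fun hx => lt_irrefl _ hx.2
  -- the densities
  set I : ℝ → ℝ := fun r =>
    ((deriv (deriv p) r / 2 + deriv p r / (2 * r)) * w r + deriv p r * deriv w r)
      * L0op k f r * r with hI
  set J : ℝ → ℝ := fun r =>
    commutatorDensity κ r (a r) (a₁ r) (D₁ r) (h r) (f r) (w r) (w₁ r) (w₂ r) with hJ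
  set S : ℝ → ℝ := fun r => f r ^ 2 * r with hS
  set E : ℝ → ℝ := fun r => ellipticDensity κ r (w r) (w₁ r) (w₂ r) with hE
  have hpos : ∀ x ∈ Icc α β, x ∈ Ioi (0 : ℝ) := fun x hx => hα.trans_le hx.1
  have hne0 : ∀ x ∈ Icc α β, x ≠ 0 := fun x hx => (hpos x hx).ne'
  have ca := sa.continuousOn.mono hpos
  have ca₁ := sa₁.continuousOn.mono hpos
  have cD₁ := sD₁.continuousOn.mono hpos
  have ch := sh.continuousOn.mono hpos
  have cf := sf.continuousOn.mono hpos
  have cLf := sLf.mono hpos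
  have cw := hw.continuous.continuousOn (s := Icc α β)
  have cw₁ := sw₁.continuous.continuousOn (s := Icc α β)
  have cw₂ := sw₂.continuous.continuousOn (s := Icc α β)
  have cI : ContinuousOn I (Icc α β) := by
    have h1 : ∀ x ∈ Icc α β, 2 * x ≠ 0 := fun x hx => mul_ne_zero two_ne_zero (hne0 x hx)
    simp only [hI, ← ha_def, ← ha₁_def, ← hw₁_def]
    fun_prop (disch := assumption)
  have cJ : ContinuousOn J (Icc α β) := by
    have h1 : ∀ x ∈ Icc α β, x ^ 2 ≠ 0 := fun x hx => pow_ne_zero 2 (hne0 x hx)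
    simp only [hJ, commutatorDensity]
    fun_prop (disch := assumption)
  have cS : ContinuousOn S (Icc α β) := by fun_prop
  have cE : ContinuousOn E (Icc α β) := by
    simp only [hE, ellipticDensity]
    fun_prop (disch := assumption)
  have ii : ∀ {φ : ℝ → ℝ}, ContinuousOn φ (Icc α β) → IntervalIntegrable φ volume α β :=
    fun hφ => hφ.intervalIntegrable_of_Icc hαβ.le
  -- integration by parts
  have eIJ : ∫ r in α..β, I r = ∫ r in α..β, J r := by
    have h1 := intervalIntegral.integral_eq_sub_of_hasDerivAt (a := α) (b := β)
      (f := fun s => s * (f s * (D₁ s / 2 * w s + D s / 2 * w₁ s + a₁ s * w₁ s + a s * w₂ s)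
        - f₁ s * (D s / 2 * w s + a s * w₁ s)) + s * a s * f s ^ 2 / 2)
      (f' := fun r => I r - J r) (fun r hr => ?_) ((ii cI).sub (ii cJ))
    · rw [intervalIntegral.integral_sub (ii cI) (ii cJ)] at h1
      simp only [zf α hαn, zf β hβn, zf₁ α hαn, zf₁ β hβn] at h1
      linarith
    · rw [uIcc_of_le hαβ.le] at hr
      have hr0 : 0 < r := hpos r hr
      have h2 := hasDerivAt_virial (κ := κ) hr0 (sa.hasDerivAt_of_pos (by norm_num) hr0)
        (D := D) rfl (sD.hasDerivAt_of_pos (by norm_num) hr0)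
        (sD₁.hasDerivAt_of_pos (by norm_num) hr0) (sf.hasDerivAt_of_pos (by simp) hr0)
        (sf₁.hasDerivAt_of_pos (by simp) hr0) (dw r) (dw₁ r) (dw₂ r) rfl
      refine h2.congr_deriv ?_
      have h3 : D r = a₁ r + a r / r := rfl
      have h4 : L0op k f r = -deriv f₁ r - f₁ r / r + κ / r ^ 2 * f r := rfl
      have h5 : deriv D₁ r + D₁ r / r = h r := rfl
      simp only [hI, hJ, h4, ← ha_def, ← ha₁_def, ← hw₁_def, ← hD₁_def, ← hf₁_def]
      rw [h5, h3]
      congr 1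
      field_simp
  have eSE : ∫ r in α..β, S r = ∫ r in α..β, E r := by
    have h1 := intervalIntegral.integral_eq_sub_of_hasDerivAt (a := α) (b := β)
      (f' := fun r => S r - E r) (fun r hr => ?_) ((ii cS).sub (ii cE))
      (f := fun s => 2 * (w₁ s - w s / s) ^ 2
        - 2 * (κ - 1) * (w s / s) * (w₁ s - w s / s) - 2 * (κ - 1) * (w s / s) ^ 2)
    · rw [intervalIntegral.integral_sub (ii cS) (ii cE)] at h1
      simp only [zw α hαn, zw β hβn, zw₁ α hαn, zw₁ β hβn] at h1
      rw [← sub_eq_zero, h1]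
      ring
    · rw [uIcc_of_le hαβ.le] at hr
      exact hasDerivAt_elliptic (hpos r hr) (dw r) (dw₁ r)
  -- reduction to the interval `[α, β]`
  have tI := setIntegral_Ioi_eq_intervalIntegral (φ := I) hα.le hαβ.le fun x hx => by
    simp [hI, ← hw₁_def, zw x hx, zw₁ x hx]
  have tS := setIntegral_Ioi_eq_intervalIntegral (φ := S) hα.le hαβ.le fun x hx => by
    simp [hS, zf x hx]
  have tR := setIntegral_Ioi_eq_intervalIntegral (φ := (Iio R).indicator S) hα.le hαβ.le
    fun x hx => by simp [hS, indicator, zf x hx]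
  rw [setIntegral_indicator measurableSet_Iio, Ioi_inter_Iio, ← integral_Ioc_eq_integral_Ioo] at tR
  rw [tI, tS, tR, eIJ]
  have iR : IntervalIntegrable ((Iio R).indicator S) volume α β := by
    rw [intervalIntegrable_iff_integrableOn_Ioc_of_le hαβ.le]
    exact ((intervalIntegrable_iff_integrableOn_Ioc_of_le hαβ.le).1 (ii cS)).indicator
      measurableSet_Iio
  have hmono : ∫ r in α..β, (2 * (Iio R).indicator S r - 67 * c * S r - 8 * c * E r)
      ≤ ∫ r in α..β, J r := by
    refine intervalIntegral.integral_mono_on hαβ.le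
      (((iR.const_mul _).sub ((ii cS).const_mul _)).sub ((ii cE).const_mul _)) (ii cJ) ?_
    intro r hr
    have hr0 : 0 < r := hpos r hr
    have h1 := commutatorDensity_lower_bound (f := f r) hκ4 hr0 hc rfl (hβ' r hr0) (hD r hr0)
      (hh r hr0)
    refine le_trans ?_ h1
    have hS0 : 0 ≤ f r ^ 2 * r := by positivity
    have h2 : (Iio R).indicator S r ≤ (a r / r + c) * (f r ^ 2 * r) := by
      by_cases hrR : r < R
      · have h3 : a r = r := by
          have h4 : p =ᶠ[nhds r] fun s => s ^ 2 / 2 := by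
            filter_upwards [Ioo_mem_nhds hr0 hrR] with s hs
            exact hpR s ⟨hs.1, hs.2.le⟩
          rw [ha_def, h4.deriv_eq]
          simp
        rw [indicator_of_mem (mem_Iio.2 hrR), h3, div_self hr0.ne']
        simp only [hS]
        nlinarith
      · rw [indicator_of_notMem (by simpa using hrR)]
        exact mul_nonneg (by linarith [hb r hr0]) hS0
    simp only [hS, hE] at h2 ⊢
    linarith
  rw [intervalIntegral.integral_sub ((iR.const_mul _).sub ((ii cS).const_mul _))
      ((ii cE).const_mul _), intervalIntegral.integral_sub (iR.const_mul _) ((ii cS).const_mul _),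
    intervalIntegral.integral_const_mul, intervalIntegral.integral_const_mul,
    intervalIntegral.integral_const_mul, ← eSE] at hmono
  linarith

end
end

section
/- Let k ≥ 4 be an integer, and set ρ_k := ((8k/π) sin(π/k))^{1/2}, γ_k := (k/2) ρ_k², q_k := ((k-2) ρ_k / 2)^{-2/(k-2)}, and λ̃(t) := q_k t^{-2/(k-2)}. Then for every ε ∈ (0, 1) there exist T > 0 and continuously differentiable functions μ, λ, a, b : [T, ∞) → ℝ with λ(t) > 0 and μ(t) > 0, solving the system μ'(t) = a(t), λ'(t) = -b(t), a'(t) = -γ_k λ(t)^k μ(t)^{-k-1}, b'(t) = -γ_k λ(t)^{k-1} μ(t)^{-k} for all t ≥ T, and satisfying the asymptotics as t → ∞: λ(t) = λ̃(t) (1 + O(λ̃(t)^{2-ε})); μ(t) = 1 - (k/(2(k+2))) λ̃(t)² + O(λ̃(t)^{3-ε}); a(t) = (k/(k+2)) ρ_k λ̃(t)^{k/2 + 1} + O(λ̃(t)^{k/2 + 2 - ε}); and b(t) = ρ_k λ̃(t)^{k/2} + O(λ̃(t)^{k/2 + 2 - ε}). -/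
open Set Filter Asymptotics

noncomputable section

/-- `q_k = ((k-2) ρ_k / 2)^{-2/(k-2)}`. -/
def qK (k : ℕ) : ℝ := (((k : ℝ) - 2) * rhoK k / 2) ^ (-2 / ((k : ℝ) - 2))

/-- `λ̃(t) = q_k t^{-2/(k-2)}`. -/
def lamTil (k : ℕ) (t : ℝ) : ℝ := qK k * t ^ (-2 / ((k : ℝ) - 2))

/-- The perturbation in the slope equation `z p' + (r+1) p = -r (1 + z² p (1+p)² / (1 - z² p))`,
with `w` in the role of `z²`. -/
def slopeTerm (w q : ℝ) : ℝ := w * (q * (1 + q) ^ 2 / (1 - w * q))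

/-- `slopeTerm` evaluated at truncated arguments. -/
def truncTerm (y p : ℝ) : ℝ := slopeTerm (min (y ^ 2) (1 / 8)) (max (-1) (min p 0))

lemma one_le_one_sub_mul {w q : ℝ} (hw : 0 ≤ w) (hq : q ≤ 0) : 1 ≤ 1 - w * q := by
  nlinarith

lemma slopeTerm_lipschitz {w q q' : ℝ} (hw : 0 ≤ w) (hw' : w ≤ 1 / 8) (h1 : -1 ≤ q) (h0 : q ≤ 0)
    (h1' : -1 ≤ q') (h0' : q' ≤ 0) :
    |slopeTerm w q - slopeTerm w q'| ≤ 1 / 2 * |q - q'| := by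
  have hD := one_le_one_sub_mul hw h0
  have hD' := one_le_one_sub_mul hw h0'
  have key : slopeTerm w q - slopeTerm w q' = w * ((1 + (q + q')) ^ 2 - q * q'
      - w * (q * q' * (2 + (q + q')))) / ((1 - w * q) * (1 - w * q')) * (q - q') := by
    unfold slopeTerm
    have : 1 - w * q ≠ 0 := by positivity
    have : 1 - w * q' ≠ 0 := by positivity
    field_simp
    ring
  have hqq : 0 ≤ q * q' := mul_nonneg_of_nonpos_of_nonpos h0 h0'
  have hqq1 : q * q' ≤ 1 := by nlinarith
  have hDD : 1 ≤ (1 - w * q) * (1 - w * q') := by nlinarith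
  have hb : |(1 + (q + q')) ^ 2 - q * q' - w * (q * q' * (2 + (q + q')))| ≤ 2 := by
    have h2 : 0 ≤ q * q' * (2 + (q + q')) := mul_nonneg hqq (by linarith)
    have h3 : q * q' * (2 + (q + q')) ≤ 2 := by nlinarith
    have h4 : 0 ≤ w * (q * q' * (2 + (q + q'))) := mul_nonneg hw h2
    have h5 : w * (q * q' * (2 + (q + q'))) ≤ 1 / 8 * 2 :=
      mul_le_mul hw' h3 h2 (by norm_num)
    rw [abs_le]
    constructor <;> nlinarith
  rw [key, abs_mul]
  refine mul_le_mul_of_nonneg_right ?_ (abs_nonneg _)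
  rw [abs_div, abs_mul, abs_of_nonneg hw, abs_of_pos (by linarith : 0 < (1 - w * q) * (1 - w * q'))]
  rw [div_le_iff₀ (by linarith)]
  have : w * |(1 + (q + q')) ^ 2 - q * q' - w * (q * q' * (2 + (q + q')))| ≤ 1 / 8 * 2 :=
      mul_le_mul hw' hb (abs_nonneg _) (by norm_num)
  linarith

lemma slopeTerm_mem {w q : ℝ} (hw : 0 ≤ w) (h1 : -1 ≤ q) (h0 : q ≤ 0) :
    -w ≤ slopeTerm w q ∧ slopeTerm w q ≤ 0 := by
  have hD := one_le_one_sub_mul hw h0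
  have hn : q * (1 + q) ^ 2 ≤ 0 := mul_nonpos_of_nonpos_of_nonneg h0 (sq_nonneg _)
  have hn' : -1 ≤ q * (1 + q) ^ 2 := by nlinarith [sq_nonneg (1 + q)]
  have hu : q * (1 + q) ^ 2 / (1 - w * q) ≤ 0 := div_nonpos_of_nonpos_of_nonneg hn (by linarith)
  have hl : -1 ≤ q * (1 + q) ^ 2 / (1 - w * q) := by
    rw [le_div_iff₀ (by linarith)]; linarith
  unfold slopeTerm
  constructor <;> nlinarith

lemma truncTerm_mem (y p : ℝ) :
    -min (y ^ 2) (1 / 8) ≤ truncTerm y p ∧ truncTerm y p ≤ 0 :=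
  slopeTerm_mem (le_min (sq_nonneg _) (by norm_num)) (le_max_left _ _)
    (max_le (by norm_num) (min_le_right _ _))

lemma truncTerm_lipschitz (y p p' : ℝ) : |truncTerm y p - truncTerm y p'| ≤ 1 / 2 * |p - p'| := by
  refine (slopeTerm_lipschitz (le_min (sq_nonneg _) (by norm_num)) (min_le_right _ _)
    (le_max_left _ _) (max_le (by norm_num) (min_le_right _ _)) (le_max_left _ _)
    (max_le (by norm_num) (min_le_right _ _))).trans ?_
  refine mul_le_mul_of_nonneg_left ?_ (by norm_num)
  have hl : LipschitzWith 1 fun x : ℝ => max (-1) (min x 0) :=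
    (LipschitzWith.id.min_const 0).const_max (-1)
  have h := hl.dist_le_mul p p'
  rwa [NNReal.coe_one, one_mul, Real.dist_eq, Real.dist_eq] at h

lemma continuous_truncTerm : Continuous fun x : ℝ × ℝ => truncTerm x.1 x.2 := by
  unfold truncTerm slopeTerm
  refine Continuous.mul (by fun_prop) (Continuous.div (by fun_prop) (by fun_prop) ?_)
  intro x
  have := one_le_one_sub_mul (w := min (x.1 ^ 2) (1 / 8)) (q := max (-1) (min x.2 0))
    (le_min (sq_nonneg _) (by norm_num)) (max_le (by norm_num) (min_le_right _ _))
  linarith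

lemma continuous_slopeIntegrand {r : ℝ} (hr : 0 ≤ r) {p : ℝ → ℝ} (hp : Continuous p) :
    Continuous fun x : ℝ × ℝ => x.2 ^ r * (1 + truncTerm (x.2 * x.1) (p (x.2 * x.1))) := by
  have h1 : Continuous fun x : ℝ × ℝ => x.2 ^ r := continuous_snd.rpow_const fun _ => Or.inr hr
  have h2 : Continuous fun x : ℝ × ℝ => truncTerm (x.2 * x.1) (p (x.2 * x.1)) :=
    continuous_truncTerm.comp (f := fun x : ℝ × ℝ => (x.2 * x.1, p (x.2 * x.1))) (by fun_prop)
  exact h1.mul (continuous_const.add h2)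

/-- The integral operator whose fixed points solve the truncated slope equation. -/
def slopeMap (r : ℝ) (p : ℝ → ℝ) (z : ℝ) : ℝ :=
  -r * ∫ s in (0 : ℝ)..1, s ^ r * (1 + truncTerm (s * z) (p (s * z)))

lemma continuous_slopeMap {r : ℝ} (hr : 0 ≤ r) {p : ℝ → ℝ} (hp : Continuous p) :
    Continuous (slopeMap r p) := by
  unfold slopeMap
  refine continuous_const.mul ?_
  exact intervalIntegral.continuous_parametric_intervalIntegral_of_continuous'
    (f := fun z s => s ^ r * (1 + truncTerm (s * z) (p (s * z))))
    (continuous_slopeIntegrand hr hp) 0 1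

lemma slopeIntegrand_intervalIntegrable {r : ℝ} (hr : 0 ≤ r) {p : ℝ → ℝ} (hp : Continuous p)
    (z : ℝ) :
    IntervalIntegrable (fun s => s ^ r * (1 + truncTerm (s * z) (p (s * z))))
      MeasureTheory.volume 0 1 :=
  ((continuous_slopeIntegrand hr hp).comp (Continuous.prodMk_right z)).intervalIntegrable 0 1

lemma integral_zero_one_rpow {r : ℝ} (hr : 0 ≤ r) : ∫ s in (0 : ℝ)..1, s ^ r = 1 / (r + 1) := by
  rw [integral_rpow (Or.inl (by linarith))]
  simp [Real.zero_rpow (by linarith : r + 1 ≠ 0)]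

lemma slopeMap_sub_le {r : ℝ} (hr : 0 ≤ r) {p q : ℝ → ℝ} (hp : Continuous p) (hq : Continuous q)
    {d : ℝ} (hd : ∀ x, |p x - q x| ≤ d) (z : ℝ) :
    |slopeMap r p z - slopeMap r q z| ≤ 1 / 2 * d := by
  have hd0 : 0 ≤ d := (abs_nonneg _).trans (hd 0)
  unfold slopeMap
  rw [← mul_sub, ← intervalIntegral.integral_sub (slopeIntegrand_intervalIntegrable hr hp z)
    (slopeIntegrand_intervalIntegrable hr hq z), abs_mul, abs_neg, abs_of_nonneg hr]
  have hb : ‖∫ s in (0 : ℝ)..1, (s ^ r * (1 + truncTerm (s * z) (p (s * z)))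
      - s ^ r * (1 + truncTerm (s * z) (q (s * z))))‖ ≤ ∫ s in (0 : ℝ)..1, s ^ r * (1 / 2 * d) := by
    refine intervalIntegral.norm_integral_le_of_norm_le zero_le_one ?_ ?_
    · refine Eventually.of_forall fun s hs => ?_
      have hs0 : 0 ≤ s ^ r := Real.rpow_nonneg hs.1.le r
      rw [← mul_sub, add_sub_add_left_eq_sub, Real.norm_eq_abs, abs_mul, abs_of_nonneg hs0]
      refine mul_le_mul_of_nonneg_left ?_ hs0
      refine (truncTerm_lipschitz _ _ _).trans ?_
      have := hd (s * z)
      linarith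
    · exact ((Real.continuous_rpow_const hr).mul continuous_const).intervalIntegrable 0 1
  rw [intervalIntegral.integral_mul_const, integral_zero_one_rpow hr, Real.norm_eq_abs] at hb
  calc r * _ ≤ r * (1 / (r + 1) * (1 / 2 * d)) := mul_le_mul_of_nonneg_left hb hr
    _ = r / (r + 1) * (1 / 2 * d) := by ring
    _ ≤ 1 * (1 / 2 * d) := by
      refine mul_le_mul_of_nonneg_right ?_ (by linarith)
      rw [div_le_one (by linarith)]; linarith
    _ = 1 / 2 * d := one_mul _

lemma slopeMap_add_le {r : ℝ} (hr : 0 ≤ r) {p : ℝ → ℝ} (hp : Continuous p) (z : ℝ) :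
    0 ≤ slopeMap r p z + r / (r + 1) ∧ slopeMap r p z + r / (r + 1) ≤ min (z ^ 2) (1 / 8) := by
  set w := min (z ^ 2) (1 / 8) with hw
  have hw0 : 0 ≤ w := le_min (sq_nonneg _) (by norm_num)
  have hc : Continuous fun s : ℝ => s ^ r := Real.continuous_rpow_const hr
  have hI := slopeIntegrand_intervalIntegrable hr hp z
  have hup : ∫ s in (0 : ℝ)..1, s ^ r * (1 + truncTerm (s * z) (p (s * z)))
      ≤ ∫ s in (0 : ℝ)..1, s ^ r := by
    refine intervalIntegral.integral_mono_on zero_le_one hI (hc.intervalIntegrable 0 1) ?_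
    intro s hs
    have := (truncTerm_mem (s * z) (p (s * z))).2
    have := Real.rpow_nonneg hs.1 r
    nlinarith
  have hlo : ∫ s in (0 : ℝ)..1, s ^ r * (1 - w)
      ≤ ∫ s in (0 : ℝ)..1, s ^ r * (1 + truncTerm (s * z) (p (s * z))) := by
    refine intervalIntegral.integral_mono_on zero_le_one
      ((hc.mul continuous_const).intervalIntegrable 0 1) hI ?_
    intro s hs
    have h1 := (truncTerm_mem (s * z) (p (s * z))).1
    have h2 : min ((s * z) ^ 2) (1 / 8) ≤ w := by
      refine min_le_min_right _ ?_
      rw [mul_pow]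
      exact mul_le_of_le_one_left (sq_nonneg _) (pow_le_one₀ hs.1 hs.2)
    exact mul_le_mul_of_nonneg_left (by linarith) (Real.rpow_nonneg hs.1 r)
  rw [intervalIntegral.integral_mul_const, integral_zero_one_rpow hr] at hlo
  rw [integral_zero_one_rpow hr] at hup
  unfold slopeMap
  have hr1 : 0 < r + 1 := by linarith
  have e : r / (r + 1) = r * (1 / (r + 1)) := by ring
  have hle : r / (r + 1) ≤ 1 := by rw [div_le_one hr1]; linarith
  constructor
  · rw [e]; nlinarith
  · have := mul_le_mul_of_nonneg_left hlo hr
    have h3 : r * (1 / (r + 1) * (1 - w)) = r / (r + 1) - r / (r + 1) * w := by ring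
    have h4 : r / (r + 1) * w ≤ w := mul_le_of_le_one_left hw0 hle
    linarith

lemma exists_slopeMap_fixed {r : ℝ} (hr : 0 ≤ r) :
    ∃ p : ℝ → ℝ, Continuous p ∧ ∀ z, slopeMap r p z = p z := by
  have hbd : ∀ p : BoundedContinuousFunction ℝ ℝ, ∀ z, ‖slopeMap r p z‖ ≤ 1 := by
    intro p z
    obtain ⟨h1, h2⟩ := slopeMap_add_le hr p.continuous z
    have h3 : min (z ^ 2) (1 / 8) ≤ 1 / 8 := min_le_right _ _
    have hr1 : 0 < r + 1 := by linarith
    have h4 : r / (r + 1) ≤ 1 := by rw [div_le_one hr1]; linarith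
    have h5 : 0 ≤ r / (r + 1) := by positivity
    rw [Real.norm_eq_abs, abs_le]
    constructor <;> linarith
  let F : BoundedContinuousFunction ℝ ℝ → BoundedContinuousFunction ℝ ℝ := fun p =>
    BoundedContinuousFunction.ofNormedAddCommGroup (slopeMap r p)
      (continuous_slopeMap hr p.continuous) 1 (hbd p)
  have hF : ContractingWith (1 / 2) F := by
    refine ⟨by norm_num, LipschitzWith.of_dist_le_mul fun p q => ?_⟩
    refine (BoundedContinuousFunction.dist_le (by positivity)).2 fun z => ?_
    have := slopeMap_sub_le hr p.continuous q.continuous (d := dist p q)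
      (fun x => by simpa [Real.dist_eq] using p.dist_coe_le_dist (g := q) x) z
    simpa [F, Real.dist_eq] using this
  refine ⟨hF.fixedPoint, (hF.fixedPoint).continuous, fun z => ?_⟩
  have := congrArg (fun f : BoundedContinuousFunction ℝ ℝ => f z) hF.fixedPoint_isFixedPt
  simpa [F] using this

lemma slopeMap_eq_div (r : ℝ) (p : ℝ → ℝ) {z : ℝ} (hz : 0 < z) :
    slopeMap r p z
      = (-r * ∫ y in (0 : ℝ)..z, y ^ r * (1 + truncTerm y (p y))) / z ^ (r + 1) := by
  have h := intervalIntegral.integral_comp_mul_right (a := 0) (b := 1)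
    (fun y => y ^ r * (1 + truncTerm y (p y))) hz.ne'
  have h2 : ∫ s in (0 : ℝ)..1, (s * z) ^ r * (1 + truncTerm (s * z) (p (s * z)))
      = z ^ r * ∫ s in (0 : ℝ)..1, s ^ r * (1 + truncTerm (s * z) (p (s * z))) := by
    rw [← intervalIntegral.integral_const_mul]
    refine intervalIntegral.integral_congr fun s hs => ?_
    rw [uIcc_of_le zero_le_one] at hs
    simp only [Real.mul_rpow hs.1 hz.le]
    ring
  rw [h2, zero_mul, one_mul, smul_eq_mul] at h
  have hzr : 0 < z ^ r := Real.rpow_pos_of_pos hz r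
  rw [slopeMap, Real.rpow_add_one hz.ne', eq_div_iff (by positivity)]
  calc _ = -r * (z * (z ^ r * ∫ s in (0 : ℝ)..1,
        s ^ r * (1 + truncTerm (s * z) (p (s * z))))) := by ring
    _ = _ := by rw [h]; field_simp

/-- The solution of the singular slope equation that is regular at `0`. -/
theorem exists_slope {r : ℝ} (hr : 0 ≤ r) :
    ∃ p : ℝ → ℝ, Continuous p ∧ (∀ z, -1 ≤ p z ∧ p z ≤ 0) ∧
      (∀ z, |p z + r / (r + 1)| ≤ z ^ 2) ∧
      ∀ z ∈ Ioc (0 : ℝ) (1 / 3),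
        HasDerivAt p ((-r * (1 + slopeTerm (z ^ 2) (p z)) - (r + 1) * p z) / z) z := by
  obtain ⟨p, hp, hfix⟩ := exists_slopeMap_fixed hr
  have hr1 : 0 < r + 1 := by linarith
  have hadd : ∀ z, 0 ≤ p z + r / (r + 1) ∧ p z + r / (r + 1) ≤ min (z ^ 2) (1 / 8) := fun z =>
    hfix z ▸ slopeMap_add_le hr hp z
  have hmem : ∀ z, -1 ≤ p z ∧ p z ≤ 0 := by
    intro z
    have hle : r / (r + 1) ≤ 1 := by rw [div_le_one hr1]; linarith
    refine ⟨by linarith [(hadd z).1], ?_⟩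
    rw [← hfix z, slopeMap]
    refine mul_nonpos_of_nonpos_of_nonneg (by linarith) ?_
    refine intervalIntegral.integral_nonneg zero_le_one fun s hs => ?_
    refine mul_nonneg (Real.rpow_nonneg hs.1 r) ?_
    have := (truncTerm_mem (s * z) (p (s * z))).1
    have : min ((s * z) ^ 2) (1 / 8) ≤ 1 / 8 := min_le_right _ _
    linarith
  refine ⟨p, hp, hmem, fun z => ?_, fun z hz => ?_⟩
  · rw [abs_of_nonneg (hadd z).1]
    exact (hadd z).2.trans (min_le_left _ _)
  · have hz0 := hz.1
    have hc : Continuous fun y : ℝ => y ^ r * (1 + truncTerm y (p y)) :=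
      (Real.continuous_rpow_const hr).mul (continuous_const.add
        (continuous_truncTerm.comp (f := fun y : ℝ => (y, p y)) (by fun_prop)))
    have hint : HasDerivAt (fun x => ∫ y in (0 : ℝ)..x, y ^ r * (1 + truncTerm y (p y)))
        (z ^ r * (1 + truncTerm z (p z))) z := hc.integral_hasStrictDerivAt 0 z |>.hasDerivAt
    have hpow : HasDerivAt (fun x : ℝ => x ^ (r + 1)) ((r + 1) * z ^ r) z := by
      simpa using Real.hasDerivAt_rpow_const (p := r + 1) (Or.inl hz0.ne')
    have hzr : 0 < z ^ r := Real.rpow_pos_of_pos hz0 r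
    have hzr1 : z ^ (r + 1) = z ^ r * z := Real.rpow_add_one hz0.ne' r
    have hne : z ^ (r + 1) ≠ 0 := by rw [hzr1]; positivity
    have hpz := slopeMap_eq_div r p hz0
    rw [hfix z] at hpz
    have htr : truncTerm z (p z) = slopeTerm (z ^ 2) (p z) := by
      rw [truncTerm, min_eq_left (by nlinarith [hz.2] : z ^ 2 ≤ 1 / 8), min_eq_left (hmem z).2,
        max_eq_right (hmem z).1]
    have hquot := ((hint.const_mul (-r)).div hpow hne)
    have heq : (fun x => -r * ∫ y in (0 : ℝ)..x, y ^ r * (1 + truncTerm y (p y)))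
        / (fun x : ℝ => x ^ (r + 1)) =ᶠ[nhds z] p := by
      filter_upwards [lt_mem_nhds hz0] with x hx
      rw [Pi.div_apply, ← slopeMap_eq_div r p hx, hfix x]
    refine (hquot.congr_of_eventuallyEq heq.symm).congr_deriv ?_
    rw [eq_div_iff hne] at hpz
    rw [← hpz, hzr1, htr]
    field_simp

lemma isBigO_mul_sub_mul {α : Type*} {l : Filter α} {f₁ f₂ g : α → ℝ} {c₁ c₂ : ℝ}
    (hg : Tendsto g l (nhds 0)) (h₁ : (fun x => f₁ x - c₁) =O[l] g)
    (h₂ : (fun x => f₂ x - c₂) =O[l] g) : (fun x => f₁ x * f₂ x - c₁ * c₂) =O[l] g := by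
  have h₃ : f₂ =O[l] (fun _ => (1 : ℝ)) := by
    have := (h₂.trans_tendsto hg).add_const c₂
    simp only [sub_add_cancel] at this
    exact this.isBigO_one ℝ
  have h₄ := h₁.mul h₃
  simp only [mul_one] at h₄
  exact (h₄.add (h₂.const_mul_left c₁)).congr_left fun x => by ring

lemma HasDerivAt.isBigO_comp_sub {α : Type*} {l : Filter α} {F : ℝ → ℝ} {F' c : ℝ} {f g : α → ℝ}
    (hF : HasDerivAt F F' c) (hg : Tendsto g l (nhds 0)) (hf : (fun x => f x - c) =O[l] g) :
    (fun x => F (f x) - F c) =O[l] g := by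
  have hfc : Tendsto f l (nhds c) := by
    have := (hf.trans_tendsto hg).add_const c
    simpa only [sub_add_cancel, zero_add] using this
  exact (hF.isBigO_sub.comp_tendsto hfc).trans hf

lemma abs_intervalIntegral_le_of_rpow_bound {g : ℝ → ℝ} {a b C α : ℝ} (hab : a ≤ b)
    (hα : 0 < α ∨ (α ≠ 0 ∧ 0 < a)) (hbd : ∀ y ∈ Ioc a b, |g y| ≤ C * y ^ (α - 1)) :
    |∫ y in a..b, g y| ≤ C * ((b ^ α - a ^ α) / α) := by
  have hα' : -1 < α - 1 ∨ α - 1 ≠ -1 ∧ (0 : ℝ) ∉ uIcc a b := by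
    rcases hα with h | ⟨h, h'⟩
    · left; linarith
    · right
      refine ⟨fun h2 => h (by linarith), fun h0 => ?_⟩
      rw [uIcc_of_le hab] at h0
      exact absurd h0.1 (not_le.2 h')
  have hint : IntervalIntegrable (fun y : ℝ => y ^ (α - 1)) MeasureTheory.volume a b := by
    rcases hα' with h | h
    · exact intervalIntegral.intervalIntegrable_rpow' h
    · exact intervalIntegral.intervalIntegrable_rpow (Or.inr h.2)
  have := intervalIntegral.norm_integral_le_of_norm_le (f := g) hab
    (Eventually.of_forall hbd) (hint.const_mul C)
  rwa [intervalIntegral.integral_const_mul, integral_rpow hα', sub_add_cancel] at this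

/-- A function that is `O(y^(β-1))` at `0⁺` has an antiderivative that is `O(y^α)` for suitable
`α ≤ β`. -/
theorem exists_antideriv_isBigO {g : ℝ → ℝ} {α β : ℝ} (hg : ContinuousOn g (Ioi 0))
    (hO : g =O[nhdsWithin 0 (Ioi 0)] fun y => y ^ (β - 1)) (hαβ : α ≤ β) (h : 0 < β ∨ α < 0) :
    ∃ h : ℝ → ℝ, (∀ z, 0 < z → HasDerivAt h (g z) z) ∧
      h =O[nhdsWithin 0 (Ioi 0)] fun y => y ^ α := by
  obtain ⟨C, hC0, hC⟩ := hO.exists_pos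
  obtain ⟨z₀, hz₀, hz₀'⟩ := mem_nhdsGT_iff_exists_Ioc_subset.1 hC.bound
  obtain ⟨d, hd0, hd1, hdz⟩ : ∃ d : ℝ, 0 < d ∧ d ≤ 1 ∧ d ≤ z₀ :=
    ⟨min 1 z₀, lt_min one_pos hz₀, min_le_left _ _, min_le_right _ _⟩
  have hbd : ∀ y ∈ Ioc 0 d, |g y| ≤ C * y ^ (β - 1) := by
    intro y hy
    have := hz₀' ⟨hy.1, hy.2.trans hdz⟩
    simpa [Real.norm_eq_abs, abs_of_nonneg (Real.rpow_nonneg hy.1.le _)] using this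
  have hgi : ∀ a b, 0 < a → 0 < b → IntervalIntegrable g MeasureTheory.volume a b := by
    intro a b ha hb
    refine (hg.mono fun y hy => ?_).intervalIntegrable
    exact (lt_min ha hb).trans_le hy.1
  have hderiv : ∀ a z, 0 < z → IntervalIntegrable g MeasureTheory.volume a z →
      HasDerivAt (fun x => ∫ y in a..x, g y) (g z) z := by
    intro a z hz hi
    refine intervalIntegral.integral_hasDerivAt_right hi ?_ (hg.continuousAt (Ioi_mem_nhds hz))
    exact hg.stronglyMeasurableAtFilter isOpen_Ioi z hz
  have hmem : Ioc 0 d ∈ nhdsWithin (0 : ℝ) (Ioi 0) := Ioc_mem_nhdsGT hd0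
  rcases h with hβ | hα
  · have hi0 : IntervalIntegrable g MeasureTheory.volume 0 d := by
      have hint : IntervalIntegrable (fun y : ℝ => C * y ^ (β - 1)) MeasureTheory.volume 0 d :=
        (intervalIntegral.intervalIntegrable_rpow' (by linarith)).const_mul C
      refine hint.mono_fun ?_ ?_
      · rw [uIoc_of_le hd0.le]
        exact (hg.mono fun y hy => hy.1).aestronglyMeasurable measurableSet_Ioc
      · rw [uIoc_of_le hd0.le]
        refine (MeasureTheory.ae_restrict_iff' measurableSet_Ioc).2 (Eventually.of_forall ?_)
        intro y hy
        exact (hbd y hy).trans (le_abs_self _)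
    have hi : ∀ z, 0 < z → IntervalIntegrable g MeasureTheory.volume 0 z := fun z hz =>
      hi0.trans (hgi d z hd0 hz)
    refine ⟨fun x => ∫ y in (0 : ℝ)..x, g y, fun z hz => hderiv 0 z hz (hi z hz), ?_⟩
    refine IsBigO.of_bound (C / β) ?_
    filter_upwards [hmem] with z hz
    have h1 := abs_intervalIntegral_le_of_rpow_bound (g := g) hz.1.le (Or.inl hβ)
      (fun y hy => hbd y ⟨hy.1, hy.2.trans hz.2⟩)
    rw [Real.zero_rpow hβ.ne', sub_zero] at h1
    rw [Real.norm_eq_abs, Real.norm_eq_abs, abs_of_nonneg (Real.rpow_nonneg hz.1.le _)]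
    have h2 : z ^ β ≤ z ^ α := Real.rpow_le_rpow_of_exponent_ge hz.1 (hz.2.trans hd1) hαβ
    calc _ ≤ _ := h1
      _ = C / β * z ^ β := by ring
      _ ≤ C / β * z ^ α := by gcongr
  · refine ⟨fun x => ∫ y in d..x, g y, fun z hz => hderiv d z hz (hgi d z hd0 hz), ?_⟩
    refine IsBigO.of_bound (C / -α) ?_
    filter_upwards [hmem] with z hz
    have hbd' : ∀ y ∈ Ioc z d, |g y| ≤ C * y ^ (α - 1) := by
      intro y hy
      have hy0 : 0 < y := hz.1.trans hy.1
      refine (hbd y ⟨hy0, hy.2⟩).trans (mul_le_mul_of_nonneg_left ?_ hC0.le)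
      exact Real.rpow_le_rpow_of_exponent_ge hy0 (hy.2.trans hd1) (by linarith)
    have h1 := abs_intervalIntegral_le_of_rpow_bound (g := g) hz.2
      (Or.inr ⟨hα.ne, hz.1⟩) hbd'
    rw [intervalIntegral.integral_symm, norm_neg, Real.norm_eq_abs, Real.norm_eq_abs,
      abs_of_nonneg (Real.rpow_nonneg hz.1.le _)]
    have h2 : 0 < d ^ α := Real.rpow_pos_of_pos hd0 α
    calc _ ≤ _ := h1
      _ = C / -α * z ^ α - C / -α * d ^ α := by
        field_simp
        ring
      _ ≤ C / -α * z ^ α := by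
        have : 0 < C / -α := div_pos hC0 (by linarith)
        nlinarith

/-- Inversion of a strictly decreasing function that blows up at `0⁺`. -/
theorem exists_inverse_of_tendsto_atTop {τ τ' : ℝ → ℝ} {d : ℝ} (hd : 0 < d)
    (hτ : ∀ z ∈ Ioc 0 d, HasDerivAt τ (τ' z) z) (hneg : ∀ z ∈ Ioc 0 d, τ' z < 0)
    (hlim : Tendsto τ (nhdsWithin 0 (Ioi 0)) atTop) :
    ∃ T : ℝ, ∃ ζ : ℝ → ℝ, (∀ t, T < t → ζ t ∈ Ioo 0 d ∧ τ (ζ t) = t ∧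
      HasDerivAt ζ (τ' (ζ t))⁻¹ t) ∧ Tendsto ζ atTop (nhdsWithin 0 (Ioi 0)) := by
  have hcont : ContinuousOn τ (Ioc 0 d) := fun z hz => (hτ z hz).continuousAt.continuousWithinAt
  have hanti : StrictAntiOn τ (Ioc 0 d) := by
    refine strictAntiOn_of_deriv_neg (convex_Ioc 0 d) hcont fun z hz => ?_
    have hz' := interior_subset hz
    rw [(hτ z hz').deriv]
    exact hneg z hz'
  have hdm : d ∈ Ioc 0 d := ⟨hd, le_rfl⟩
  have hex : ∀ t, τ d < t → ∃ z ∈ Ioo 0 d, τ z = t := by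
    intro t ht
    obtain ⟨y, hyt, hy⟩ := ((hlim.eventually_gt_atTop t).and (Ioo_mem_nhdsGT hd)).exists
    obtain ⟨z, hz, hzt⟩ := intermediate_value_Ioo' hy.2.le
      (hcont.mono fun x hx => ⟨hy.1.trans_le hx.1, hx.2⟩) ⟨ht, hyt⟩
    exact ⟨z, ⟨hy.1.trans hz.1, hz.2⟩, hzt⟩
  choose! ζ hζ hζτ using hex
  have hζm : ∀ t, τ d < t → ζ t ∈ Ioc 0 d := fun t ht => Ioo_subset_Ioc_self (hζ t ht)
  have hζanti : StrictAntiOn ζ (Ioi (τ d)) := by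
    intro s hs t ht hst
    rw [← hanti.lt_iff_gt (hζm s hs) (hζm t ht), hζτ s hs, hζτ t ht]
    exact hst
  have hleft : ∀ z ∈ Ioo 0 d, ζ (τ z) = z := by
    intro z hz
    have hzd : τ d < τ z := hanti (Ioo_subset_Ioc_self hz) hdm hz.2
    exact hanti.injOn (hζm _ hzd) (Ioo_subset_Ioc_self hz) (hζτ _ hzd)
  have hζcont : ∀ t, τ d < t → ContinuousAt ζ t := by
    intro t ht
    have himg : Ioo 0 d ⊆ ζ '' Ioi (τ d) := fun z hz =>
      ⟨τ z, hanti (Ioo_subset_Ioc_self hz) hdm hz.2, hleft z hz⟩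
    have hm : StrictMonoOn (fun s => -ζ s) (Ioi (τ d)) := hζanti.neg
    have := hm.continuousAt_of_image_mem_nhds (Ioi_mem_nhds ht) (a := t) ?_
    · simpa only [Pi.neg_def, neg_neg] using this.neg
    · refine mem_of_superset (Ioo_mem_nhds (a := -d) (b := 0) (neg_lt_neg (hζ t ht).2)
        (neg_lt_zero.2 (hζ t ht).1)) fun x hx => ?_
      obtain ⟨s, hs, hsx⟩ := himg (show -x ∈ Ioo 0 d from ⟨by linarith [hx.2], by linarith [hx.1]⟩)
      exact ⟨s, hs, by simp [hsx]⟩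
  refine ⟨τ d, ζ, fun t ht => ⟨hζ t ht, hζτ t ht, ?_⟩, ?_⟩
  · refine HasDerivAt.of_local_left_inverse (hζcont t ht) (hτ _ (hζm t ht))
      (hneg _ (hζm t ht)).ne ?_
    filter_upwards [lt_mem_nhds ht] with s hs using hζτ s hs
  · refine tendsto_nhdsWithin_iff.2 ⟨?_, ?_⟩
    · refine Metric.tendsto_atTop.2 fun η hη => ?_
      obtain ⟨y, hy0, hyη, hyd⟩ : ∃ y, 0 < y ∧ y < η ∧ y < d := by
        obtain ⟨y, hy⟩ := exists_between (lt_min hη hd)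
        exact ⟨y, hy.1, hy.2.trans_le (min_le_left _ _), hy.2.trans_le (min_le_right _ _)⟩
      have hyd' : τ d < τ y := hanti ⟨hy0, hyd.le⟩ hdm hyd
      refine ⟨τ y, fun t ht => ?_⟩
      have h1 : ζ t ≤ ζ (τ y) := hζanti.antitoneOn hyd' (hyd'.trans_le ht) ht
      rw [hleft y ⟨hy0, hyd⟩] at h1
      rw [Real.dist_eq, sub_zero, abs_of_pos (hζ t (hyd'.trans_le ht)).1]
      linarith
    · filter_upwards [eventually_gt_atTop (τ d)] with t ht using (hζ t ht).1

/-- The outer scale `μ` as a function of the ratio `z = λ/μ`, for the slope `dμ/dλ = z p(z)`. -/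
def outerScale (p : ℝ → ℝ) (z : ℝ) : ℝ :=
  Real.exp (∫ y in (0 : ℝ)..z, y * p y / (1 - y ^ 2 * p y))

/-- The inner velocity `b` as a function of the ratio `z = λ/μ` on the zero energy level. -/
def innerVelocity (ρ r : ℝ) (p : ℝ → ℝ) (z : ℝ) : ℝ :=
  ρ * z ^ r / Real.sqrt (1 + (z * p z) ^ 2)

lemma continuous_scaleRate {p : ℝ → ℝ} (hp : Continuous p) (h0 : ∀ z, p z ≤ 0) :
    Continuous fun y => y * p y / (1 - y ^ 2 * p y) := by
  refine Continuous.div (by fun_prop) (by fun_prop) fun y => ?_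
  linarith [one_le_one_sub_mul (sq_nonneg y) (h0 y)]

lemma outerScale_pos (p : ℝ → ℝ) (z : ℝ) : 0 < outerScale p z := Real.exp_pos _

lemma hasDerivAt_outerScale {p : ℝ → ℝ} (hp : Continuous p) (h0 : ∀ z, p z ≤ 0) (z : ℝ) :
    HasDerivAt (outerScale p) (outerScale p z * (z * p z / (1 - z ^ 2 * p z))) z :=
  ((continuous_scaleRate hp h0).integral_hasStrictDerivAt 0 z).hasDerivAt.exp

lemma tendsto_sq_nhdsGT_zero : Tendsto (fun z : ℝ => z ^ 2) (nhdsWithin 0 (Ioi 0)) (nhds 0) := by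
  have : Tendsto (fun z : ℝ => z ^ 2) (nhds 0) (nhds (0 ^ 2)) := (continuous_pow 2).tendsto 0
  rw [zero_pow two_ne_zero] at this
  exact this.mono_left nhdsWithin_le_nhds

lemma outerScale_isBigO {p : ℝ → ℝ} (hp : Continuous p) (hmem : ∀ z, -1 ≤ p z ∧ p z ≤ 0)
    {c : ℝ} (hc : ∀ z, |p z + c| ≤ z ^ 2) :
    (fun z => outerScale p z - (1 - c / 2 * z ^ 2))
      =O[nhdsWithin 0 (Ioi 0)] fun z : ℝ => z ^ 4 := by
  have hcont := continuous_scaleRate hp fun z => (hmem z).2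
  have hL : ∀ z ∈ Ioc (0 : ℝ) 1,
      |(∫ y in (0 : ℝ)..z, y * p y / (1 - y ^ 2 * p y)) + c / 2 * z ^ 2| ≤ z ^ 4 := by
    intro z hz
    have hid : ∫ y in (0 : ℝ)..z, c * y = c / 2 * z ^ 2 := by
      rw [intervalIntegral.integral_const_mul, integral_id]; ring
    rw [← hid, ← intervalIntegral.integral_add (hcont.intervalIntegrable _ _)
      ((continuous_const_mul c).intervalIntegrable _ _)]
    have hbd : ∀ y ∈ Ioc 0 z, ‖y * p y / (1 - y ^ 2 * p y) + c * y‖ ≤ 4 * y ^ 3 := by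
      intro y hy
      have hD := one_le_one_sub_mul (sq_nonneg y) (hmem y).2
      have e : y * p y / (1 - y ^ 2 * p y) + c * y
          = y * (p y + c) + y ^ 3 * (p y ^ 2 / (1 - y ^ 2 * p y)) := by
        have : 1 - y ^ 2 * p y ≠ 0 := by positivity
        field_simp
        ring
      have h1 : p y ^ 2 / (1 - y ^ 2 * p y) ≤ 1 := by
        rw [div_le_one (by linarith)]
        nlinarith [hmem y]
      have h2 : 0 ≤ p y ^ 2 / (1 - y ^ 2 * p y) := by positivity
      have hy3 : 0 < y ^ 3 := pow_pos hy.1 3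
      rw [e, Real.norm_eq_abs]
      calc _ ≤ |y * (p y + c)| + |y ^ 3 * (p y ^ 2 / (1 - y ^ 2 * p y))| := abs_add_le _ _
        _ ≤ y * y ^ 2 + y ^ 3 * 1 := by
          rw [abs_mul, abs_of_pos hy.1, abs_of_nonneg (mul_nonneg hy3.le h2)]
          gcongr
          · exact hy.1.le
          · exact hc y
        _ ≤ 4 * y ^ 3 := by linarith [show y * y ^ 2 = y ^ 3 by ring]
    have := intervalIntegral.norm_integral_le_of_norm_le (f := fun y =>
      y * p y / (1 - y ^ 2 * p y) + c * y) hz.1.le (Eventually.of_forall hbd)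
      ((by fun_prop : Continuous fun y : ℝ => 4 * y ^ 3).intervalIntegrable (μ := MeasureTheory.volume) 0 z)
    rw [intervalIntegral.integral_const_mul, integral_pow, Real.norm_eq_abs] at this
    norm_num at this
    linarith
  have hL' : ∀ z ∈ Ioc (0 : ℝ) 1, |∫ y in (0 : ℝ)..z, y * p y / (1 - y ^ 2 * p y)| ≤ z ^ 2 := by
    intro z hz
    have hbd : ∀ y ∈ Ioc 0 z, ‖y * p y / (1 - y ^ 2 * p y)‖ ≤ y := by
      intro y hy
      have hD := one_le_one_sub_mul (sq_nonneg y) (hmem y).2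
      rw [Real.norm_eq_abs, abs_div, abs_of_pos (by linarith : 0 < 1 - y ^ 2 * p y),
        div_le_iff₀ (by linarith), abs_mul, abs_of_pos hy.1]
      refine mul_le_mul_of_nonneg_left ?_ hy.1.le
      rw [abs_of_nonpos (hmem y).2]
      linarith [hmem y]
    have := intervalIntegral.norm_integral_le_of_norm_le (f := fun y =>
      y * p y / (1 - y ^ 2 * p y)) hz.1.le (Eventually.of_forall hbd)
      ((by fun_prop : Continuous fun y : ℝ => y).intervalIntegrable (μ := MeasureTheory.volume) 0 z)
    rw [Real.norm_eq_abs] at this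
    refine this.trans ?_
    rw [integral_id]
    nlinarith [sq_nonneg z]
  refine IsBigO.of_bound 2 ?_
  filter_upwards [Ioc_mem_nhdsGT (one_pos (α := ℝ))] with z hz
  have h1 := hL z hz
  have h2 := hL' z hz
  unfold outerScale
  set L := ∫ y in (0 : ℝ)..z, y * p y / (1 - y ^ 2 * p y)
  have h3 := Real.abs_exp_sub_one_sub_id_le (h2.trans (pow_le_one₀ hz.1.le hz.2))
  have h4 : L ^ 2 ≤ z ^ 4 := by
    calc L ^ 2 = |L| ^ 2 := (sq_abs L).symm
      _ ≤ (z ^ 2) ^ 2 := by gcongr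
      _ = z ^ 4 := by ring
  rw [Real.norm_eq_abs, Real.norm_eq_abs, abs_of_pos (pow_pos hz.1 4)]
  calc _ = |(Real.exp L - 1 - L) + (L + c / 2 * z ^ 2)| := by congr 1; ring
    _ ≤ _ := abs_add_le _ _
    _ ≤ 2 * z ^ 4 := by linarith

lemma outerScale_sub_one_isBigO {p : ℝ → ℝ} (hp : Continuous p)
    (hmem : ∀ z, -1 ≤ p z ∧ p z ≤ 0) {c : ℝ} (hc : ∀ z, |p z + c| ≤ z ^ 2) :
    (fun z => outerScale p z - 1) =O[nhdsWithin 0 (Ioi 0)] fun z : ℝ => z ^ 2 := by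
  have h1 : (fun z : ℝ => z ^ 4) =O[nhdsWithin 0 (Ioi 0)] fun z : ℝ => z ^ 2 := by
    refine IsBigO.of_bound 1 ?_
    filter_upwards [Ioc_mem_nhdsGT (one_pos (α := ℝ))] with z hz
    rw [one_mul, Real.norm_eq_abs, Real.norm_eq_abs, abs_of_pos (pow_pos hz.1 4),
      abs_of_pos (pow_pos hz.1 2)]
    exact pow_le_pow_of_le_one hz.1.le hz.2 (by norm_num)
  have h2 := ((outerScale_isBigO hp hmem hc).trans h1).sub
    ((isBigO_refl (fun z : ℝ => z ^ 2) _).const_mul_left (c / 2))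
  exact h2.congr_left fun z => by ring

lemma sq_mul_isBigO {p : ℝ → ℝ} (hmem : ∀ z, -1 ≤ p z ∧ p z ≤ 0) (l : Filter ℝ) :
    (fun z => z ^ 2 * p z) =O[l] fun z : ℝ => z ^ 2 := by
  refine IsBigO.of_bound 1 (Eventually.of_forall fun z => ?_)
  rw [norm_mul, one_mul]
  refine mul_le_of_le_one_right (norm_nonneg _) ?_
  rw [Real.norm_eq_abs, abs_of_nonpos (hmem z).2]
  linarith [hmem z]

lemma inv_sqrt_sub_one_isBigO {p : ℝ → ℝ} (hmem : ∀ z, -1 ≤ p z ∧ p z ≤ 0) :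
    (fun z => (Real.sqrt (1 + (z * p z) ^ 2))⁻¹ - 1) =O[nhdsWithin 0 (Ioi 0)]
      fun z : ℝ => z ^ 2 := by
  have h1 : (fun z => (1 + (z * p z) ^ 2) - 1) =O[nhdsWithin 0 (Ioi 0)] fun z : ℝ => z ^ 2 := by
    refine IsBigO.of_bound 1 (Eventually.of_forall fun z => ?_)
    rw [add_sub_cancel_left, mul_pow, norm_mul, one_mul]
    refine mul_le_of_le_one_right (norm_nonneg _) ?_
    rw [Real.norm_eq_abs, abs_of_nonneg (sq_nonneg _)]
    nlinarith [hmem z]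
  have hF : HasDerivAt (fun x : ℝ => (Real.sqrt x)⁻¹) (-(1 / (2 * Real.sqrt 1)) / Real.sqrt 1 ^ 2)
      1 := (Real.hasDerivAt_sqrt one_ne_zero).fun_inv (by simp)
  simpa using hF.isBigO_comp_sub tendsto_sq_nhdsGT_zero h1

/-- The density `dt/dz`, normalised by its leading term, is `1 + O(z²)`. -/
lemma timeDensity_isBigO {p : ℝ → ℝ} (hp : Continuous p)
    (hmem : ∀ z, -1 ≤ p z ∧ p z ≤ 0) {c : ℝ} (hc : ∀ z, |p z + c| ≤ z ^ 2) :
    (fun z => outerScale p z * ((Real.sqrt (1 + (z * p z) ^ 2))⁻¹ * (1 - z ^ 2 * p z))⁻¹ - 1)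
      =O[nhdsWithin 0 (Ioi 0)] fun z : ℝ => z ^ 2 := by
  have h1 : (fun z => (1 - z ^ 2 * p z) - 1) =O[nhdsWithin 0 (Ioi 0)] fun z : ℝ => z ^ 2 :=
    (sq_mul_isBigO hmem _).neg_left.congr_left fun z => by ring
  have hg := tendsto_sq_nhdsGT_zero
  have h2 := isBigO_mul_sub_mul hg (inv_sqrt_sub_one_isBigO hmem) h1
  have h3 := (hasDerivAt_inv (by norm_num : (1 : ℝ) * 1 ≠ 0)).isBigO_comp_sub hg h2
  have h4 := isBigO_mul_sub_mul hg (outerScale_sub_one_isBigO hp hmem hc) h3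
  simpa using h4

section Profile

variable {r ρ : ℝ} {p : ℝ → ℝ} {z : ℝ}

lemma hasDerivAt_mul_slope (hz : 0 < z) (h0 : p z ≤ 0)
    (hd : HasDerivAt p ((-r * (1 + slopeTerm (z ^ 2) (p z)) - (r + 1) * p z) / z) z) :
    HasDerivAt (fun y => y * p y)
      (-r * (1 + (z * p z) ^ 2) * (1 + p z) / (1 - z ^ 2 * p z)) z := by
  refine ((hasDerivAt_id z).mul hd).congr_deriv ?_
  have hD := one_le_one_sub_mul (sq_nonneg z) h0
  have : 1 - z ^ 2 * p z ≠ 0 := by positivity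
  simp only [id, slopeTerm]
  obtain ⟨D, hDz⟩ : ∃ D, D = 1 - z ^ 2 * p z := ⟨_, rfl⟩
  rw [← hDz] at this ⊢
  field_simp
  rw [hDz]
  ring

lemma innerVelocity_pos (hρ : 0 < ρ) (hz : 0 < z) : 0 < innerVelocity ρ r p z :=
  div_pos (mul_pos hρ (Real.rpow_pos_of_pos hz r)) (Real.sqrt_pos.2 (by positivity))

lemma innerVelocity_sq : innerVelocity ρ r p z ^ 2 * (1 + (z * p z) ^ 2) = ρ ^ 2 * (z ^ r) ^ 2 := by
  have h : 0 < 1 + (z * p z) ^ 2 := by positivity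
  rw [innerVelocity, div_pow, Real.sq_sqrt h.le, mul_pow, div_mul_cancel₀ _ h.ne']

lemma hasDerivAt_innerVelocity (hz : 0 < z) (h0 : p z ≤ 0)
    (hd : HasDerivAt p ((-r * (1 + slopeTerm (z ^ 2) (p z)) - (r + 1) * p z) / z) z) :
    HasDerivAt (innerVelocity ρ r p)
      (innerVelocity ρ r p z * (r * (1 + (z * p z) ^ 2) / (z * (1 - z ^ 2 * p z)))) z := by
  have hP := hasDerivAt_mul_slope hz h0 hd
  have hD := one_le_one_sub_mul (sq_nonneg z) h0
  have hDne : 1 - z ^ 2 * p z ≠ 0 := by positivity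
  have hQ2 : 0 < 1 + (z * p z) ^ 2 := by positivity
  have hQ := Real.sqrt_pos.2 hQ2
  have hpow : HasDerivAt (fun y : ℝ => y ^ r) (r * (z ^ r / z)) z := by
    have := Real.hasDerivAt_rpow_const (x := z) (p := r) (Or.inl hz.ne')
    rwa [Real.rpow_sub_one hz.ne'] at this
  have hs := ((hP.fun_pow 2).const_add 1).sqrt hQ2.ne'
  refine ((hpow.const_mul ρ).div hs hQ.ne').congr_deriv ?_
  have hsq := Real.sq_sqrt hQ2.le
  unfold innerVelocity
  set Q := Real.sqrt (1 + (z * p z) ^ 2)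
  rw [← hsq]
  field_simp
  push_cast
  linear_combination (-2 * ρ * r) * hsq

end Profile

section Trajectory

variable {r ρ : ℝ} {p ζ : ℝ → ℝ} {t : ℝ}

/-- The speed `-dz/dt` along the zero energy trajectory. -/
def ratioSpeed (ρ r : ℝ) (p : ℝ → ℝ) (z : ℝ) : ℝ :=
  innerVelocity ρ r p z * (1 - z ^ 2 * p z) / outerScale p z

lemma hasDerivAt_outer_comp (hp : Continuous p) (h0 : ∀ z, p z ≤ 0)
    (hζ : HasDerivAt ζ (-ratioSpeed ρ r p (ζ t)) t) :
    HasDerivAt (fun s => outerScale p (ζ s))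
      (-innerVelocity ρ r p (ζ t) * (ζ t * p (ζ t))) t := by
  refine ((hasDerivAt_outerScale hp h0 (ζ t)).comp t hζ).congr_deriv ?_
  have hM := (outerScale_pos p (ζ t)).ne'
  have hD := one_le_one_sub_mul (sq_nonneg (ζ t)) (h0 (ζ t))
  have : 1 - ζ t ^ 2 * p (ζ t) ≠ 0 := by positivity
  unfold ratioSpeed
  field_simp

lemma hasDerivAt_inner_comp (hp : Continuous p) (h0 : ∀ z, p z ≤ 0)
    (hζ : HasDerivAt ζ (-ratioSpeed ρ r p (ζ t)) t) :
    HasDerivAt (fun s => ζ s * outerScale p (ζ s)) (-innerVelocity ρ r p (ζ t)) t := by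
  refine (hζ.mul (hasDerivAt_outer_comp hp h0 hζ)).congr_deriv ?_
  have hM := (outerScale_pos p (ζ t)).ne'
  unfold ratioSpeed
  field_simp
  ring

lemma hasDerivAt_innerVelocity_comp (h0 : p (ζ t) ≤ 0) (hz : 0 < ζ t)
    (hd : HasDerivAt p ((-r * (1 + slopeTerm (ζ t ^ 2) (p (ζ t))) - (r + 1) * p (ζ t)) / ζ t)
      (ζ t))
    (hζ : HasDerivAt ζ (-ratioSpeed ρ r p (ζ t)) t) :
    HasDerivAt (fun s => innerVelocity ρ r p (ζ s))
      (-(r * ρ ^ 2) * (ζ t ^ r) ^ 2 / (ζ t * outerScale p (ζ t))) t := by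
  refine ((hasDerivAt_innerVelocity hz h0 hd).comp t hζ).congr_deriv ?_
  have hM := (outerScale_pos p (ζ t)).ne'
  have hD := one_le_one_sub_mul (sq_nonneg (ζ t)) h0
  have : 1 - ζ t ^ 2 * p (ζ t) ≠ 0 := by positivity
  have hsq := innerVelocity_sq (ρ := ρ) (r := r) (p := p) (z := ζ t)
  unfold ratioSpeed
  field_simp
  linear_combination (-r) * hsq

lemma hasDerivAt_outerVelocity_comp (h0 : p (ζ t) ≤ 0) (hz : 0 < ζ t)
    (hd : HasDerivAt p ((-r * (1 + slopeTerm (ζ t ^ 2) (p (ζ t))) - (r + 1) * p (ζ t)) / ζ t)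
      (ζ t))
    (hζ : HasDerivAt ζ (-ratioSpeed ρ r p (ζ t)) t) :
    HasDerivAt (fun s => -innerVelocity ρ r p (ζ s) * (ζ s * p (ζ s)))
      (-(r * ρ ^ 2) * (ζ t ^ r) ^ 2 / outerScale p (ζ t)) t := by
  refine ((hasDerivAt_innerVelocity_comp h0 hz hd hζ).neg.mul
    ((hasDerivAt_mul_slope hz h0 hd).comp t hζ)).congr_deriv ?_
  have hM := (outerScale_pos p (ζ t)).ne'
  have hD := one_le_one_sub_mul (sq_nonneg (ζ t)) h0
  obtain ⟨D, hDz⟩ : ∃ D, D = 1 - ζ t ^ 2 * p (ζ t) := ⟨_, rfl⟩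
  have hDne : D ≠ 0 := by rw [hDz]; positivity
  have hsq := innerVelocity_sq (ρ := ρ) (r := r) (p := p) (z := ζ t)
  simp only [ratioSpeed, Pi.neg_apply, Function.comp_apply]
  rw [← hDz]
  field_simp
  linear_combination (-r * (1 + p (ζ t))) * hsq

end Trajectory

/-- The zero energy trajectory together with the comparison of `z = λ/μ` with the pure power
`((r-1) ρ t)^(-1/(r-1))`. -/
theorem exists_ratio {r ρ ε : ℝ} {p : ℝ → ℝ} (hr : 1 < r) (hρ : 0 < ρ) (hε : ε ∈ Ioo (0 : ℝ) 1)
    (hrε : r < 3 ∨ 3 < r + ε) (hp : Continuous p) (hmem : ∀ z, -1 ≤ p z ∧ p z ≤ 0)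
    {c : ℝ} (hc : ∀ z, |p z + c| ≤ z ^ 2) {d : ℝ} (hd : 0 < d) :
    ∃ T : ℝ, ∃ ζ : ℝ → ℝ,
      (∀ t, T < t → ζ t ∈ Ioo 0 d ∧ HasDerivAt ζ (-ratioSpeed ρ r p (ζ t)) t) ∧
      Tendsto ζ atTop (nhdsWithin 0 (Ioi 0)) ∧
      (fun t => ζ t / ((r - 1) * ρ * t) ^ (-1 / (r - 1)) - 1) =O[atTop]
        fun t => ζ t ^ (2 - ε) := by
  have hm : 0 < r - 1 := by linarith
  set S : ℝ → ℝ := fun z =>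
    outerScale p z * ((Real.sqrt (1 + (z * p z) ^ 2))⁻¹ * (1 - z ^ 2 * p z))⁻¹ with hS
  have hSO : (fun z => S z - 1) =O[nhdsWithin 0 (Ioi 0)] fun z : ℝ => z ^ 2 :=
    timeDensity_isBigO hp hmem hc
  have hSc : Continuous S := by
    have hMc : Continuous (outerScale p) := continuous_iff_continuousAt.2 fun z =>
      (hasDerivAt_outerScale hp (fun z => (hmem z).2) z).continuousAt
    have hsq : ∀ z, Real.sqrt (1 + (z * p z) ^ 2) ≠ 0 := fun z =>
      (Real.sqrt_pos.2 (by positivity)).ne'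
    have hD : ∀ z, 1 - z ^ 2 * p z ≠ 0 := fun z => by
      linarith [one_le_one_sub_mul (sq_nonneg z) (hmem z).2]
    exact hMc.mul (Continuous.inv₀ (((by fun_prop : Continuous fun z =>
      Real.sqrt (1 + (z * p z) ^ 2)).inv₀ hsq).mul (by fun_prop))
      fun z => mul_ne_zero (inv_ne_zero (hsq z)) (hD z))
  have hgc : ContinuousOn (fun z => -ρ⁻¹ * z ^ (-r) * (S z - 1)) (Ioi 0) := by
    refine ContinuousOn.mul (ContinuousOn.mul continuousOn_const ?_)
      (hSc.continuousOn.sub continuousOn_const)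
    exact continuousOn_id.rpow_const fun x hx => Or.inl (ne_of_gt hx)
  have hgO : (fun z => -ρ⁻¹ * z ^ (-r) * (S z - 1)) =O[nhdsWithin 0 (Ioi 0)]
      fun z : ℝ => z ^ (3 - r - 1) := by
    have h1 := ((isBigO_refl (fun z : ℝ => z ^ (-r)) (nhdsWithin 0 (Ioi 0))).const_mul_left
      (-ρ⁻¹)).mul hSO
    refine h1.trans_eventuallyEq ?_
    filter_upwards [self_mem_nhdsWithin] with z hz
    rw [← Real.rpow_natCast z 2, ← Real.rpow_add hz]
    congr 1
    push_cast
    ring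
  obtain ⟨h, hh, hhO⟩ := exists_antideriv_isBigO (α := 3 - r - ε) hgc hgO (by linarith [hε.1])
    (hrε.imp (fun h => by linarith) fun h => by linarith)
  set η : ℝ → ℝ := fun z => (r - 1) * ρ * (h z * z ^ (r - 1)) with hη
  have hηO : η =O[nhdsWithin 0 (Ioi 0)] fun z : ℝ => z ^ (2 - ε) := by
    have h1 := (hhO.mul (isBigO_refl (fun z : ℝ => z ^ (r - 1)) _)).const_mul_left ((r - 1) * ρ)
    refine h1.trans_eventuallyEq ?_
    filter_upwards [self_mem_nhdsWithin] with z hz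
    rw [← Real.rpow_add hz]
    congr 1
    ring
  have hgauge : Tendsto (fun z : ℝ => z ^ (2 - ε)) (nhdsWithin 0 (Ioi 0)) (nhds 0) := by
    have := (Real.continuousAt_rpow_const 0 (2 - ε) (Or.inr (by linarith [hε.2]))).tendsto
    rw [Real.zero_rpow (by linarith [hε.2])] at this
    exact this.mono_left nhdsWithin_le_nhds
  have hη0 : Tendsto η (nhdsWithin 0 (Ioi 0)) (nhds 0) := hηO.trans_tendsto hgauge
  set τ : ℝ → ℝ := fun z => ((r - 1) * ρ)⁻¹ * z ^ (-(r - 1)) + h z with hτ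
  have hτη : ∀ z, 0 < z → (r - 1) * ρ * τ z = z ^ (-(r - 1)) * (1 + η z) := by
    intro z hz
    have : z ^ (-(r - 1)) * z ^ (r - 1) = 1 := by
      rw [← Real.rpow_add hz, neg_add_cancel, Real.rpow_zero]
    simp only [hτ, hη]
    field_simp
    linear_combination (-(r - 1) * ρ * h z) * this
  have hτd : ∀ z, 0 < z → HasDerivAt τ (-(ratioSpeed ρ r p z)⁻¹) z := by
    intro z hz
    have h1 := Real.hasDerivAt_rpow_const (x := z) (p := -(r - 1)) (Or.inl hz.ne')
    refine ((h1.const_mul ((r - 1) * ρ)⁻¹).add (hh z hz)).congr_deriv ?_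
    rw [show -(r - 1) - 1 = -r by ring, Real.rpow_neg hz.le]
    have hzr := (Real.rpow_pos_of_pos hz r).ne'
    have hM := (outerScale_pos p z).ne'
    have hQ : Real.sqrt (1 + (z * p z) ^ 2) ≠ 0 := (Real.sqrt_pos.2 (by positivity)).ne'
    obtain ⟨D, hDz⟩ : ∃ D, D = 1 - z ^ 2 * p z := ⟨_, rfl⟩
    have hD : D ≠ 0 := by linarith [one_le_one_sub_mul (sq_nonneg z) (hmem z).2]
    simp only [hS, ratioSpeed, innerVelocity, ← hDz]
    field_simp
    ring
  have hspeed : ∀ z, 0 < z → 0 < ratioSpeed ρ r p z := fun z hz =>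
    div_pos (mul_pos (innerVelocity_pos hρ hz)
      (by linarith [one_le_one_sub_mul (sq_nonneg z) (hmem z).2])) (outerScale_pos p z)
  have hlim : Tendsto τ (nhdsWithin 0 (Ioi 0)) atTop := by
    have h1 : Tendsto (fun z : ℝ => z ^ (-(r - 1))) (nhdsWithin 0 (Ioi 0)) atTop :=
      tendsto_rpow_neg_nhdsGT_zero (by linarith)
    have h2 := h1.atTop_mul_pos one_pos (by simpa using hη0.const_add 1)
    have h3 := h2.const_mul_atTop (inv_pos.2 (mul_pos hm hρ))
    refine h3.congr' ?_
    filter_upwards [self_mem_nhdsWithin] with z hz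
    rw [← hτη z hz]
    field_simp
  obtain ⟨T, ζ, hζ, hζ0⟩ := exists_inverse_of_tendsto_atTop hd (fun z hz => hτd z hz.1)
    (fun z hz => neg_lt_zero.2 (inv_pos.2 (hspeed z hz.1))) hlim
  refine ⟨T, ζ, fun t ht => ⟨(hζ t ht).1, ?_⟩, hζ0, ?_⟩
  · simpa [inv_neg] using (hζ t ht).2.2
  · have hF : HasDerivAt (fun x : ℝ => x ^ (1 / (r - 1))) _ 1 :=
      Real.hasDerivAt_rpow_const (Or.inl one_ne_zero)
    have h1 : (fun z => (1 + η z) - 1) =O[nhdsWithin 0 (Ioi 0)] fun z : ℝ => z ^ (2 - ε) :=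
      hηO.congr_left fun z => by ring
    have h2 := (hF.isBigO_comp_sub hgauge h1).comp_tendsto hζ0
    refine h2.congr' ?_ EventuallyEq.rfl
    filter_upwards [eventually_gt_atTop T, hζ0.eventually
      (hη0.eventually_const_lt (by norm_num : (-1 : ℝ) < 0))] with t ht hηt
    obtain ⟨⟨hz, -⟩, hτt, -⟩ := hζ t ht
    have hpos : 0 < 1 + η (ζ t) := by linarith
    simp only [Function.comp_apply, Real.one_rpow]
    congr 1
    have h3 := hτη (ζ t) hz
    rw [hτt] at h3
    rw [h3, Real.mul_rpow (Real.rpow_nonneg hz.le _) hpos.le, ← Real.rpow_mul hz.le,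
      show -(r - 1) * (-1 / (r - 1)) = 1 by field_simp, Real.rpow_one,
      show -1 / (r - 1) = -(1 / (r - 1)) by ring, Real.rpow_neg hpos.le]
    rw [← div_div, div_self hz.ne', one_div, one_div, inv_inv]

lemma rhoK_pos {k : ℕ} (hk : 4 ≤ k) : 0 < rhoK k := by
  have hk' : (4 : ℝ) ≤ k := by exact_mod_cast hk
  refine Real.sqrt_pos.2 (mul_pos (by have := Real.pi_pos; positivity) ?_)
  refine Real.sin_pos_of_pos_of_lt_pi (div_pos Real.pi_pos (by linarith)) ?_
  exact div_lt_self Real.pi_pos (by linarith)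

lemma lamTil_eq {k : ℕ} (hk : 4 ≤ k) {t : ℝ} (ht : 0 ≤ t) :
    lamTil k t = (((k : ℝ) / 2 - 1) * rhoK k * t) ^ (-1 / ((k : ℝ) / 2 - 1)) := by
  have hk' : (4 : ℝ) ≤ k := by exact_mod_cast hk
  have hρ := rhoK_pos hk
  have e : -2 / ((k : ℝ) - 2) = -1 / ((k : ℝ) / 2 - 1) := by
    rw [div_eq_div_iff (by linarith) (by linarith)]; ring
  rw [lamTil, qK, e, Real.mul_rpow (mul_nonneg (by linarith) hρ.le) ht]
  congr 2
  ring

lemma isBigO_rpow_of_le {f : ℝ → ℝ} {l : Filter ℝ} (hf : Tendsto f l (nhdsWithin 0 (Ioi 0)))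
    {x y : ℝ} (hxy : y ≤ x) : (fun t => f t ^ x) =O[l] fun t => f t ^ y := by
  refine IsBigO.of_bound 1 ?_
  filter_upwards [hf (Ioc_mem_nhdsGT one_pos)] with t ht
  rw [one_mul, Real.norm_eq_abs, Real.norm_eq_abs, abs_of_pos (Real.rpow_pos_of_pos ht.1 x),
    abs_of_pos (Real.rpow_pos_of_pos ht.1 y)]
  exact Real.rpow_le_rpow_of_exponent_ge ht.1 ht.2 hxy

/-- A relative error of size `O(f^e)` on a quantity of size `f^x`. -/
lemma isBigO_rpow_mul_sub {f g u : ℝ → ℝ} {l : Filter ℝ} (hf : Tendsto f l (nhdsWithin 0 (Ioi 0)))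
    {A x y e c : ℝ} (hu : (fun t => u t - c) =O[l] fun t => f t ^ e) (hy : y ≤ x + e)
    (hg : g =ᶠ[l] fun t => A * f t ^ x * u t) :
    (fun t => g t - A * c * f t ^ x) =O[l] fun t => f t ^ y := by
  have h1 := ((isBigO_refl (fun t => f t ^ x) l).mul hu).const_mul_left A
  refine IsBigO.trans (h1.congr' ?_ ?_) (isBigO_rpow_of_le hf hy)
  · filter_upwards [hg] with t ht
    rw [ht]
    ring
  · filter_upwards [hf self_mem_nhdsWithin] with t ht using (Real.rpow_add ht x e).symm

theorem profile_asymptotics {r ρ ε : ℝ} {p ζ f : ℝ → ℝ} (hε : ε ∈ Ioo (0 : ℝ) 1)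
    (hp : Continuous p) (hmem : ∀ z, -1 ≤ p z ∧ p z ≤ 0) {c : ℝ} (hc : ∀ z, |p z + c| ≤ z ^ 2)
    (hζ : Tendsto ζ atTop (nhdsWithin 0 (Ioi 0))) (hf : Tendsto f atTop (nhdsWithin 0 (Ioi 0)))
    (hR : (fun t => ζ t / f t - 1) =O[atTop] fun t => ζ t ^ (2 - ε)) :
    (fun t => ζ t * outerScale p (ζ t) - f t) =O[atTop] (fun t => f t ^ (3 - ε)) ∧
    (fun t => outerScale p (ζ t) - (1 - c / 2 * f t ^ 2)) =O[atTop] (fun t => f t ^ (3 - ε)) ∧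
    (fun t => -innerVelocity ρ r p (ζ t) * (ζ t * p (ζ t)) - ρ * c * f t ^ (r + 1))
      =O[atTop] (fun t => f t ^ (r + 2 - ε)) ∧
    (fun t => innerVelocity ρ r p (ζ t) - ρ * 1 * f t ^ r)
      =O[atTop] (fun t => f t ^ (r + 2 - ε)) := by
  have hrpow0 : ∀ {g : ℝ → ℝ}, Tendsto g atTop (nhdsWithin 0 (Ioi 0)) →
      Tendsto (fun t => g t ^ (2 - ε)) atTop (nhds 0) := by
    intro g hg
    have := (Real.continuousAt_rpow_const 0 (2 - ε) (Or.inr (by linarith [hε.2]))).tendsto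
    rw [Real.zero_rpow (by linarith [hε.2])] at this
    exact this.comp (hg.mono_right nhdsWithin_le_nhds)
  have hfpos : ∀ᶠ t in atTop, 0 < f t := hf self_mem_nhdsWithin
  have hζpos : ∀ᶠ t in atTop, 0 < ζ t := hζ self_mem_nhdsWithin
  have hζf : ζ =O[atTop] f := by
    have h1 : (fun t => ζ t / f t) =O[atTop] fun _ => (1 : ℝ) := by
      have := (hR.trans_tendsto (hrpow0 hζ)).add_const 1
      simp only [sub_add_cancel] at this
      exact this.isBigO_one ℝ
    refine (h1.mul (isBigO_refl f atTop)).congr' ?_ (by simp)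
    filter_upwards [hfpos] with t ht using div_mul_cancel₀ _ ht.ne'
  have hgauge : ∀ x : ℝ, 0 ≤ x → (fun t => ζ t ^ x) =O[atTop] fun t => f t ^ x := fun x hx =>
    hζf.rpow hx (hfpos.mono fun t ht => ht.le)
  have hG := hrpow0 hf
  have hGle := hgauge (2 - ε) (by linarith [hε.2])
  have hlift : ∀ {u : ℝ → ℝ}, u =O[nhdsWithin 0 (Ioi 0)] (fun z : ℝ => z ^ 2) →
      (fun t => u (ζ t)) =O[atTop] fun t => f t ^ (2 - ε) := by
    intro u hu
    refine (hu.comp_tendsto hζ).trans (IsBigO.trans ?_ hGle)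
    refine (isBigO_rpow_of_le hζ (x := 2) (y := 2 - ε) (by linarith [hε.1])).congr_left fun t => ?_
    exact Real.rpow_two _
  have hR' := hR.trans hGle
  have hM := hlift (outerScale_sub_one_isBigO hp hmem hc)
  have hQ := hlift (inv_sqrt_sub_one_isBigO hmem)
  have hP : (fun t => -p (ζ t) - c) =O[atTop] fun t => f t ^ (2 - ε) := by
    refine hlift (u := fun z => -p z - c) (IsBigO.of_bound 1 (Eventually.of_forall fun z => ?_))
    rw [one_mul, Real.norm_eq_abs, Real.norm_eq_abs, abs_of_nonneg (sq_nonneg z),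
      ← abs_neg, show -(-p z - c) = p z + c by ring]
    exact hc z
  have hRpow : ∀ x : ℝ, (fun t => (ζ t / f t) ^ x - 1) =O[atTop] fun t => f t ^ (2 - ε) := by
    intro x
    have hF : HasDerivAt (fun y : ℝ => y ^ x) _ 1 := Real.hasDerivAt_rpow_const (Or.inl one_ne_zero)
    simpa using hF.isBigO_comp_sub hG hR'
  have hsplit : ∀ x : ℝ, ∀ᶠ t in atTop, ζ t ^ x = f t ^ x * (ζ t / f t) ^ x := by
    intro x
    filter_upwards [hfpos, hζpos] with t h1 h2
    rw [← Real.mul_rpow h1.le (div_pos h2 h1).le, mul_div_cancel₀ _ h1.ne']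
  refine ⟨?_, ?_, ?_, ?_⟩
  · have h1 := isBigO_mul_sub_mul hG hR' hM
    refine (isBigO_rpow_mul_sub (g := fun t => ζ t * outerScale p (ζ t)) hf h1 (A := 1) (x := 1)
      (y := 3 - ε) (by linarith) ?_).congr_left fun t => by simp
    filter_upwards [hfpos] with t ht
    rw [Real.rpow_one]
    field_simp
  · have h1 : (fun t => outerScale p (ζ t) - (1 - c / 2 * ζ t ^ 2)) =O[atTop]
        fun t => f t ^ (3 - ε) := by
      refine ((outerScale_isBigO hp hmem hc).comp_tendsto hζ).trans (IsBigO.trans ?_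
        (hgauge (3 - ε) (by linarith [hε.2])))
      refine (isBigO_rpow_of_le hζ (x := (4 : ℕ)) (y := 3 - ε)
        (by push_cast; linarith [hε.1])).congr_left fun t => Real.rpow_natCast _ _
    have h2 : (fun t => c / 2 * ζ t ^ 2 - c / 2 * 1 * f t ^ (2 : ℝ)) =O[atTop]
        fun t => f t ^ (3 - ε) := by
      refine isBigO_rpow_mul_sub hf (hRpow 2) (by linarith) ?_
      filter_upwards [hsplit 2] with t ht
      rw [← Real.rpow_two, ht, mul_assoc]
    refine (h1.sub h2).congr_left fun t => ?_
    rw [Real.rpow_two]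
    ring
  · have h1 := isBigO_mul_sub_mul hG (isBigO_mul_sub_mul hG (hRpow (r + 1)) hQ) hP
    rw [one_mul, one_mul] at h1
    refine isBigO_rpow_mul_sub hf h1 (by linarith) ?_
    filter_upwards [hsplit (r + 1), hζpos] with t ht hz
    rw [Real.rpow_add_one hz.ne'] at ht
    rw [innerVelocity]
    linear_combination (-ρ * (Real.sqrt (1 + (ζ t * p (ζ t)) ^ 2))⁻¹ * p (ζ t)) * ht
  · have h1 := isBigO_mul_sub_mul hG (hRpow r) hQ
    rw [one_mul] at h1
    refine isBigO_rpow_mul_sub hf h1 (by linarith) ?_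
    filter_upwards [hsplit r] with t ht
    rw [← mul_assoc, mul_assoc ρ, ← ht, innerVelocity]
    ring

/-- existence of solutions to the formal modulation system
`μ' = a`, `λ' = -b`, `a' = -γ_k λ^k μ^{-k-1}`, `b' = -γ_k λ^{k-1} μ^{-k}`
on `[T,∞)` with the stated asymptotics as `t → ∞`. -/
theorem stmt19 (k : ℕ) (hk : 4 ≤ k) :
    ∀ ε : ℝ, ε ∈ Ioo (0 : ℝ) 1 →
      ∃ T : ℝ, 0 < T ∧
      ∃ mu lam a b : ℝ → ℝ,
        (∀ t ∈ Ici T, 0 < lam t ∧ 0 < mu t) ∧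
        (∀ t ∈ Ici T, HasDerivWithinAt mu (a t) (Ici T) t) ∧
        (∀ t ∈ Ici T, HasDerivWithinAt lam (-b t) (Ici T) t) ∧
        (∀ t ∈ Ici T,
          HasDerivWithinAt a (-gammaK k * lam t ^ k * mu t ^ (-(k : ℤ) - 1)) (Ici T) t) ∧
        (∀ t ∈ Ici T,
          HasDerivWithinAt b (-gammaK k * lam t ^ (k - 1) * mu t ^ (-(k : ℤ))) (Ici T) t) ∧
        (fun t => lam t - lamTil k t) =O[atTop] (fun t => lamTil k t ^ (3 - ε)) ∧
        (fun t => mu t - (1 - (k : ℝ) / (2 * ((k : ℝ) + 2)) * lamTil k t ^ 2))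
          =O[atTop] (fun t => lamTil k t ^ (3 - ε)) ∧
        (fun t => a t - (k : ℝ) / ((k : ℝ) + 2) * rhoK k * lamTil k t ^ ((k : ℝ) / 2 + 1))
          =O[atTop] (fun t => lamTil k t ^ ((k : ℝ) / 2 + 2 - ε)) ∧
        (fun t => b t - rhoK k * lamTil k t ^ ((k : ℝ) / 2))
          =O[atTop] (fun t => lamTil k t ^ ((k : ℝ) / 2 + 2 - ε)) := by
  intro ε hε
  have hk' : (4 : ℝ) ≤ k := by exact_mod_cast hk
  have hρ := rhoK_pos hk
  obtain ⟨p, hp, hmem, hc, hpd⟩ := exists_slope (r := (k : ℝ) / 2) (by positivity)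
  have hrε : (k : ℝ) / 2 < 3 ∨ 3 < (k : ℝ) / 2 + ε := by
    rcases lt_or_ge k 6 with h | h
    · have : (k : ℝ) < 6 := by exact_mod_cast h
      left; linarith
    · have : (6 : ℝ) ≤ k := by exact_mod_cast h
      right; linarith [hε.1]
  obtain ⟨T, ζ, hζ, hζ0, hR⟩ := exists_ratio (d := 1 / 3) (by linarith) hρ hε hrε hp hmem hc
    (by norm_num)
  have hf : Tendsto (lamTil k) atTop (nhdsWithin 0 (Ioi 0)) := by
    have hm : 0 < (k : ℝ) / 2 - 1 := by linarith
    have hC : 0 < ((k : ℝ) / 2 - 1) * rhoK k := mul_pos hm hρ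
    refine Tendsto.congr' (f₁ := fun t =>
      (((k : ℝ) / 2 - 1) * rhoK k * t) ^ (-(1 / ((k : ℝ) / 2 - 1)))) ?_ ?_
    · filter_upwards [eventually_ge_atTop 0] with t ht
      rw [lamTil_eq hk ht, neg_div]
    · refine tendsto_nhdsWithin_iff.2 ⟨(tendsto_rpow_neg_atTop (by positivity)).comp
        (tendsto_id.const_mul_atTop hC), ?_⟩
      filter_upwards [eventually_gt_atTop 0] with t ht
      exact Real.rpow_pos_of_pos (mul_pos hC ht) _
  have hR' : (fun t => ζ t / lamTil k t - 1) =O[atTop] fun t => ζ t ^ (2 - ε) := by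
    refine hR.congr' ?_ EventuallyEq.rfl
    filter_upwards [eventually_ge_atTop 0] with t ht
    rw [lamTil_eq hk ht]
  obtain ⟨hlam, hmu, ha, hb⟩ := profile_asymptotics (r := (k : ℝ) / 2) (ρ := rhoK k) hε hp hmem hc
    hζ0 hf hR'
  have h0 : ∀ z, p z ≤ 0 := fun z => (hmem z).2
  have hT : ∀ t ∈ Ici (max T 0 + 1), T < t := fun t ht => by
    have := le_max_left T 0
    have : max T 0 + 1 ≤ t := ht
    linarith
  have hpow : ∀ z : ℝ, 0 < z → (z ^ ((k : ℝ) / 2)) ^ 2 = z ^ k := by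
    intro z hz
    rw [← Real.rpow_natCast, ← Real.rpow_mul hz.le, ← Real.rpow_natCast]
    congr 1
    push_cast
    ring
  have e : (k : ℝ) / 2 / ((k : ℝ) / 2 + 1) = k / (k + 2) := by
    rw [div_eq_div_iff (by linarith) (by linarith)]; ring
  refine ⟨max T 0 + 1, by linarith [le_max_right T 0], fun t => outerScale p (ζ t),
    fun t => ζ t * outerScale p (ζ t),
    fun t => -innerVelocity (rhoK k) ((k : ℝ) / 2) p (ζ t) * (ζ t * p (ζ t)),
    fun t => innerVelocity (rhoK k) ((k : ℝ) / 2) p (ζ t), ?_, ?_, ?_, ?_, ?_, hlam, ?_, ?_, ?_⟩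
  · intro t ht
    exact ⟨mul_pos (hζ t (hT t ht)).1.1 (outerScale_pos p _), outerScale_pos p _⟩
  · intro t ht
    exact (hasDerivAt_outer_comp hp h0 (hζ t (hT t ht)).2).hasDerivWithinAt
  · intro t ht
    exact (hasDerivAt_inner_comp hp h0 (hζ t (hT t ht)).2).hasDerivWithinAt
  · intro t ht
    obtain ⟨⟨hz, hz3⟩, hd⟩ := hζ t (hT t ht)
    refine ((hasDerivAt_outerVelocity_comp (h0 _) hz (hpd _ ⟨hz, hz3.le⟩) hd).congr_deriv
      ?_).hasDerivWithinAt
    have hM := (outerScale_pos p (ζ t)).ne'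
    rw [hpow _ hz, mul_pow, zpow_sub_one₀ hM, zpow_neg, zpow_natCast, gammaK]
    field_simp
  · intro t ht
    obtain ⟨⟨hz, hz3⟩, hd⟩ := hζ t (hT t ht)
    refine ((hasDerivAt_innerVelocity_comp (h0 _) hz (hpd _ ⟨hz, hz3.le⟩) hd).congr_deriv
      ?_).hasDerivWithinAt
    have hM := (outerScale_pos p (ζ t)).ne'
    obtain ⟨j, rfl⟩ : ∃ j, k = j + 1 := ⟨k - 1, by omega⟩
    rw [hpow _ hz, Nat.add_sub_cancel, mul_pow, zpow_neg, zpow_natCast, gammaK]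
    field_simp
    ring
  · refine hmu.congr_left fun t => ?_
    rw [e, div_div, mul_comm ((k : ℝ) + 2)]
  · refine ha.congr_left fun t => ?_
    rw [e, mul_comm (rhoK k)]
  · exact hb.congr_left fun t => by rw [mul_one]

end
end
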